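/- arXiv:math/0508358 — 2 statements merged into one kernel-verified Lean document; each statement's English description precedes it below -/
import Mathlib

section
/- Let (R,m) be a Noetherian local ring of positive prime characteristic p. If S is a seed over R and T is an R-algebra containing S such that T is integral over S, then T is a seed over R. -/
open IsLocalRing

universe u v w

/-- `x` is a system of parameters of the local ring `R`: a sequence of `dim R` elements
of the maximal ideal generating an ideal primary to the maximal ideal. -/
def IsSOP (R : Type*) [CommRing R] [IsLocalRing R] {n : ℕ} (x : Fin n → R) : Prop :=
  (n : WithBot ℕ∞) = ringKrullDim R ∧
  (∀ i, x i ∈ maximalIdeal R) ∧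
  (Ideal.span (Set.range x)).radical = maximalIdeal R

/-- The sequence `x` of elements of `R` is a regular sequence on the `R`-module `M`. -/
def IsRegSeq (R : Type*) [CommRing R] (M : Type*) [AddCommGroup M] [Module R M]
    {n : ℕ} (x : Fin n → R) : Prop :=
  RingTheory.Sequence.IsRegular M (List.ofFn x)

/-- `B` is a big Cohen-Macaulay algebra over the local ring `R`: some system of
parameters of `R` is a regular sequence on `B` (and in particular `mB ≠ B`). -/
def IsBigCM (R : Type*) [CommRing R] [IsLocalRing R]
    (B : Type*) [CommRing B] [Algebra R B] : Prop :=
  (∃ (n : ℕ) (x : Fin n → R), IsSOP R x ∧ IsRegSeq R B x) ∧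
  (maximalIdeal R).map (algebraMap R B) ≠ ⊤

/-- `B` is a balanced big Cohen-Macaulay algebra over the local ring `R`: every system of
parameters of `R` is a regular sequence on `B` (and in particular `mB ≠ B`). -/
def IsBalancedBigCM (R : Type*) [CommRing R] [IsLocalRing R]
    (B : Type*) [CommRing B] [Algebra R B] : Prop :=
  (∀ (n : ℕ) (x : Fin n → R), IsSOP R x → IsRegSeq R B x) ∧
  (maximalIdeal R).map (algebraMap R B) ≠ ⊤

/-- `S` is a seed over the local ring `R`: `S` admits an `R`-algebra homomorphism to some
big Cohen-Macaulay `R`-algebra. -/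
def IsSeed (R : Type u) [CommRing R] [IsLocalRing R]
    (S : Type v) [CommRing S] [Algebra R S] : Prop :=
  ∃ (B : Type (max u v)) (_ : CommRing B) (_ : Algebra R B),
    IsBigCM R B ∧ Nonempty (S →ₐ[R] B)

/-- The list `ys` is weakly regular on the ring `A` modulo the ideal `I`. -/
def RegularModulo {A : Type*} [CommRing A] (I : Ideal A) : List A → Prop
  | [] => True
  | y :: ys => (∀ r, y * r ∈ I → r ∈ I) ∧ RegularModulo (I ⊔ Ideal.span {y}) ys

namespace RegularModulo

variable {A : Type*} [CommRing A]

lemma mem_of_swap {I : Ideal A} {x y : A} (hx : ∀ r, x * r ∈ I → r ∈ I)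
    (hy : ∀ r, y * r ∈ I ⊔ Ideal.span {x} → r ∈ I ⊔ Ideal.span {x}) (r : A)
    (hr : x * r ∈ I ⊔ Ideal.span {y}) : r ∈ I ⊔ Ideal.span {y} := by
  obtain ⟨i, hi, s, hs, h⟩ := Submodule.mem_sup.1 hr
  obtain ⟨s, rfl⟩ := Ideal.mem_span_singleton'.1 hs
  have h₁ : y * s ∈ I ⊔ Ideal.span {x} := by
    rw [show y * s = -i + r * x by linear_combination h]
    exact Submodule.add_mem_sup (I.neg_mem hi) (Ideal.mem_span_singleton'.2 ⟨_, rfl⟩)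
  obtain ⟨j, hj, u, hu, h₂⟩ := Submodule.mem_sup.1 (hy s h₁)
  obtain ⟨u, rfl⟩ := Ideal.mem_span_singleton'.1 hu
  have h₃ : r - y * u ∈ I := hx _ <| by
    rw [show x * (r - y * u) = i + j * y by linear_combination -h - y * h₂]
    exact I.add_mem hi (I.mul_mem_right _ hj)
  rw [show r = (r - y * u) + u * y by ring]
  exact Submodule.add_mem_sup h₃ (Ideal.mem_span_singleton'.2 ⟨_, rfl⟩)

lemma mem_sup_pow {I : Ideal A} {x y : A} (hx : ∀ r, x * r ∈ I → r ∈ I)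
    (hy : ∀ r, y * r ∈ I ⊔ Ideal.span {x} → r ∈ I ⊔ Ideal.span {x}) (a : ℕ) (r : A)
    (hr : y * r ∈ I ⊔ Ideal.span {x ^ a}) : r ∈ I ⊔ Ideal.span {x ^ a} := by
  induction a generalizing r with
  | zero => simp
  | succ a ih =>
    have hle : I ⊔ Ideal.span {x ^ (a + 1)} ≤ I ⊔ Ideal.span {x} :=
      sup_le_sup_left (by
        rw [Ideal.span_singleton_le_span_singleton]; exact dvd_pow_self _ (by simp)) _
    obtain ⟨j, hj, u, hu, h₂⟩ := Submodule.mem_sup.1 (hy r (hle hr))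
    obtain ⟨u, rfl⟩ := Ideal.mem_span_singleton'.1 hu
    obtain ⟨i, hi, v, hv, h⟩ := Submodule.mem_sup.1 hr
    obtain ⟨v, rfl⟩ := Ideal.mem_span_singleton'.1 hv
    have h₃ : y * u - v * x ^ a ∈ I := hx _ <| by
      rw [show x * (y * u - v * x ^ a) = i - j * y by
        linear_combination -h + y * h₂]
      exact I.sub_mem hi (I.mul_mem_right _ hj)
    have h₄ : y * u ∈ I ⊔ Ideal.span {x ^ a} := by
      rw [show y * u = (y * u - v * x ^ a) + v * x ^ a by ring]
      exact Submodule.add_mem_sup h₃ (Ideal.mem_span_singleton'.2 ⟨_, rfl⟩)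
    obtain ⟨i', hi', w, hw, h₅⟩ := Submodule.mem_sup.1 (ih u h₄)
    obtain ⟨w, rfl⟩ := Ideal.mem_span_singleton'.1 hw
    rw [show r = (j + i' * x) + w * x ^ (a + 1) by linear_combination -h₂ - x * h₅]
    exact Submodule.add_mem_sup (I.add_mem hj (I.mul_mem_right _ hi'))
      (Ideal.mem_span_singleton'.2 ⟨_, rfl⟩)

lemma sup_pow {I : Ideal A} {x : A} {ys : List A} (hx : ∀ r, x * r ∈ I → r ∈ I)
    (h : RegularModulo (I ⊔ Ideal.span {x}) ys) (a : ℕ) :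
    RegularModulo (I ⊔ Ideal.span {x ^ a}) ys := by
  induction ys generalizing I with
  | nil => trivial
  | cons y ys ih =>
    refine ⟨mem_sup_pow hx h.1 a, ?_⟩
    rw [sup_right_comm]
    refine ih (mem_of_swap hx h.1) ?_
    rw [sup_right_comm]
    exact h.2

lemma map_pow {I : Ideal A} {ys : List A} (h : RegularModulo I ys) (a : ℕ) :
    RegularModulo I (ys.map (· ^ a)) := by
  induction ys generalizing I with
  | nil => trivial
  | cons y ys ih =>
    refine ⟨?_, sup_pow h.1 (ih h.2) a⟩
    clear ih
    induction a with
    | zero => simp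
    | succ a iha => exact fun r hr => h.1 _ (iha _ (by simpa only [pow_succ, mul_assoc] using hr))

lemma mem_sup_ofList {I : Ideal A} {x : A} {ys : List A} (h : RegularModulo I (x :: ys)) (r : A)
    (hr : x * r ∈ I ⊔ Ideal.ofList ys) : r ∈ I ⊔ Ideal.ofList ys := by
  induction ys generalizing I with
  | nil => simpa using h.1 r (by simpa using hr)
  | cons y ys ih =>
    rw [Ideal.ofList_cons, ← sup_assoc] at hr ⊢
    refine ih ⟨mem_of_swap h.1 h.2.1, ?_⟩ hr
    rw [sup_right_comm]
    exact h.2.2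

end RegularModulo

/-- The vector `y` with all coordinates from the `k`-th on replaced by `0`. -/
def truncate {A : Type*} [Zero A] {n : ℕ} (y : Fin n → A) (k : Fin n) : Fin n → A :=
  fun i => if i < k then y i else 0

/-- The vector `y` is a weakly regular sequence on the ring `A`. -/
def RegularVector {A : Type*} [CommRing A] {n : ℕ} (y : Fin n → A) : Prop :=
  ∀ (k : Fin n) (r : A), y k * r ∈ Ideal.span (Set.range (truncate y k)) →
    r ∈ Ideal.span (Set.range (truncate y k))

section

variable {A : Type*} [CommRing A] {n : ℕ}

lemma map_truncate {B : Type*} [CommRing B] (f : A →+* B) (y : Fin n → A) (k : Fin n) :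
    f ∘ truncate y k = truncate (f ∘ y) k := by
  ext i; simp only [truncate, Function.comp]; split_ifs <;> simp

lemma truncate_pow (y : Fin n → A) (k : Fin n) {t : ℕ} (ht : t ≠ 0) :
    truncate (fun i => y i ^ t) k = fun i => truncate y k i ^ t := by
  ext i; simp only [truncate]; split_ifs <;> simp [ht]

lemma span_range_truncate_zero (y : Fin (n + 1) → A) :
    Ideal.span (Set.range (truncate y 0)) = ⊥ := by
  rw [Ideal.span_eq_bot]; rintro _ ⟨i, rfl⟩; simp [truncate]

lemma span_range_succ (y : Fin (n + 1) → A) :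
    Ideal.span (Set.range y) =
      Ideal.span {y 0} ⊔ Ideal.span (Set.range fun i : Fin n => y i.succ) := by
  rw [← Ideal.span_union]
  congr 1
  ext a
  simp [Fin.exists_fin_succ, eq_comm]

lemma span_range_truncate_succ (y : Fin (n + 1) → A) (k : Fin n) :
    Ideal.span (Set.range (truncate y k.succ)) =
      Ideal.span {y 0} ⊔ Ideal.span (Set.range (truncate (fun i => y i.succ) k)) := by
  rw [span_range_succ]
  simp [truncate, Fin.succ_lt_succ_iff]
  rfl

lemma ofList_ofFn (y : Fin n → A) : Ideal.ofList (List.ofFn y) = Ideal.span (Set.range y) := by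
  rw [Ideal.ofList]; congr 1; ext a; simp

lemma regularModulo_ofFn_iff (I : Ideal A) (y : Fin n → A) :
    RegularModulo I (List.ofFn y) ↔ ∀ (k : Fin n) (r : A),
      y k * r ∈ I ⊔ Ideal.span (Set.range (truncate y k)) →
        r ∈ I ⊔ Ideal.span (Set.range (truncate y k)) := by
  induction n generalizing I with
  | zero => simp [RegularModulo]
  | succ n ih =>
    rw [List.ofFn_succ, Fin.forall_fin_succ]
    simp only [RegularModulo, ih, span_range_truncate_zero, span_range_truncate_succ, sup_assoc,
      sup_bot_eq]

lemma regularVector_iff (y : Fin n → A) : RegularVector y ↔ RegularModulo ⊥ (List.ofFn y) := by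
  simp [regularModulo_ofFn_iff, RegularVector]

lemma RegularVector.pow {y : Fin n → A} (h : RegularVector y) (t : ℕ) :
    RegularVector fun i => y i ^ t := by
  rw [regularVector_iff] at h ⊢
  have := h.map_pow t
  rwa [List.map_ofFn] at this

lemma RegularModulo.mem_sup_span_range_pow {I : Ideal A} {y : Fin n → A}
    (h : RegularModulo I (List.ofFn y)) (k : Fin n) (t : ℕ) (r : A)
    (hr : y k * r ∈ I ⊔ Ideal.span (Set.range (truncate y k)) ⊔
      Ideal.span (Set.range fun i => y i ^ (t + 1))) :
    r ∈ I ⊔ Ideal.span (Set.range (truncate y k)) ⊔ Ideal.span (Set.range fun i => y i ^ t) := by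
  induction n generalizing I with
  | zero => exact k.elim0
  | succ n ih =>
    rw [List.ofFn_succ] at h
    induction k using Fin.cases with
    | zero =>
      rw [span_range_truncate_zero, sup_bot_eq, span_range_succ] at hr ⊢
      obtain ⟨a, ha, b, hb, hab⟩ := Submodule.mem_sup.1 hr
      obtain ⟨c, hc, d, hd, rfl⟩ := Submodule.mem_sup.1 hb
      obtain ⟨c, rfl⟩ := Ideal.mem_span_singleton'.1 hc
      have h' : RegularModulo I (y 0 :: (List.ofFn fun i : Fin n => y i.succ ^ (t + 1))) := by
        refine ⟨h.1, ?_⟩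
        have := h.2.map_pow (t + 1)
        rwa [List.map_ofFn] at this
      have h₂ := h'.mem_sup_ofList (r - c * y 0 ^ t) (by
        rw [ofList_ofFn, show y 0 * (r - c * y 0 ^ t) = a + d by linear_combination -hab]
        exact Submodule.add_mem_sup ha hd)
      rw [ofList_ofFn] at h₂
      rw [show r = (r - c * y 0 ^ t) + c * y 0 ^ t by ring]
      refine Ideal.add_mem _ ((sup_le_sup_left ?_ I :) h₂)
        (Ideal.mem_sup_right (Ideal.mem_sup_left (Ideal.mem_span_singleton'.2 ⟨_, rfl⟩)))
      refine le_sup_of_le_right (Ideal.span_le.2 ?_)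
      rintro _ ⟨i, rfl⟩
      simp only [SetLike.mem_coe, pow_succ]
      exact Ideal.mul_mem_right _ _ (Ideal.subset_span ⟨i, rfl⟩)
    | succ k =>
      have key : ∀ s, I ⊔ Ideal.span (Set.range (truncate y k.succ)) ⊔
          Ideal.span (Set.range fun i => y i ^ (s + 1)) = (I ⊔ Ideal.span {y 0}) ⊔
          Ideal.span (Set.range (truncate (fun i => y i.succ) k)) ⊔
          Ideal.span (Set.range fun i : Fin n => y i.succ ^ (s + 1)) := by
        intro s
        rw [span_range_truncate_succ, span_range_succ (fun i => y i ^ (s + 1)), ← sup_assoc,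
          ← sup_assoc, sup_right_comm _ _ (Ideal.span {y 0 ^ (s + 1)})]
        congr 2
        rw [sup_eq_left]
        exact le_sup_of_le_right (by
          rw [Ideal.span_singleton_le_span_singleton]; exact dvd_pow_self _ (by simp))
      rw [key] at hr
      cases t with
      | zero =>
        refine Ideal.mem_sup_right ?_
        simp [Set.range_const]
      | succ t =>
        rw [key]
        exact ih h.2 k hr

lemma RegularVector.mem_sup_span_range_pow {y : Fin n → A} (h : RegularVector y) (k : Fin n)
    (t : ℕ) (r : A) (hr : y k * r ∈ Ideal.span (Set.range (truncate y k)) ⊔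
      Ideal.span (Set.range fun i => y i ^ (t + 1))) :
    r ∈ Ideal.span (Set.range (truncate y k)) ⊔ Ideal.span (Set.range fun i => y i ^ t) := by
  rw [regularVector_iff] at h
  simpa using h.mem_sup_span_range_pow k t r (by simpa using hr)

end

lemma ofList_take_ofFn {A : Type*} [CommRing A] {n : ℕ} (y : Fin n → A) (k : Fin n) :
    Ideal.ofList ((List.ofFn y).take k) = Ideal.span (Set.range (truncate y k)) := by
  apply le_antisymm
  · refine Ideal.span_le.2 fun a ha => ?_
    obtain ⟨j, hj, rfl⟩ := List.mem_take_iff_getElem.1 ha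
    simp only [List.length_ofFn, lt_min_iff] at hj
    refine Ideal.subset_span ⟨⟨j, hj.2⟩, ?_⟩
    simp [truncate, Fin.lt_def, hj.1]
  · refine Ideal.span_le.2 ?_
    rintro _ ⟨i, rfl⟩
    simp only [truncate]
    split_ifs with h
    · refine Ideal.subset_span (List.mem_take_iff_getElem.2 ⟨i, ?_, by simp⟩)
      simpa using h
    · exact Ideal.zero_mem _

/-- Weak regularity on an algebra is weak regularity of the image vector. -/
lemma isWeaklyRegular_ofFn_iff {R B : Type*} [CommRing R] [CommRing B] [Algebra R B] {n : ℕ}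
    (x : Fin n → R) : RingTheory.Sequence.IsWeaklyRegular B (List.ofFn x) ↔
      RegularVector (algebraMap R B ∘ x) := by
  rw [← RingTheory.Sequence.isWeaklyRegular_map_algebraMap_iff B B, List.map_ofFn,
    RingTheory.Sequence.isWeaklyRegular_iff_Fin, RegularVector,
    ← (finCongr (List.length_ofFn (f := algebraMap R B ∘ x))).forall_congr_right]
  refine forall_congr' fun i => ?_
  rw [← ofList_take_ofFn, isSMulRegular_quotient_iff_mem_of_smul_mem]
  simp
  rfl

/-- Regularity on an algebra in terms of the image vector. -/
lemma isRegular_ofFn_iff {R B : Type*} [CommRing R] [CommRing B] [Algebra R B] {n : ℕ}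
    (x : Fin n → R) : RingTheory.Sequence.IsRegular B (List.ofFn x) ↔
      RegularVector (algebraMap R B ∘ x) ∧
        (1 : B) ∉ Ideal.span (Set.range (algebraMap R B ∘ x)) := by
  rw [RingTheory.Sequence.isRegular_iff, isWeaklyRegular_ofFn_iff, ← Ideal.eq_top_iff_one,
    Set.range_comp, ← Ideal.map_span, ← ofList_ofFn, Ideal.smul_top_eq_map, ne_comm, ne_eq,
    Submodule.restrictScalars_eq_top_iff]

section Perfect

variable {A : Type*} [CommRing A] (p : ℕ) [Fact p.Prime] [CharP A p]

lemma pow_mem_span_range_pow {n : ℕ} {w : Fin n → A} {z : A} (h : z ∈ Ideal.span (Set.range w))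
    (e : ℕ) : z ^ p ^ e ∈ Ideal.span (Set.range fun i => w i ^ p ^ e) := by
  obtain ⟨c, rfl⟩ := Ideal.mem_span_range_iff_exists_fun.1 h
  rw [sum_pow_char_pow]
  exact Ideal.mem_span_range_iff_exists_fun.2 ⟨fun i => c i ^ p ^ e, by simp [mul_pow]⟩

lemma pow_mem_span_range_pow_iff [PerfectRing A p] {n : ℕ} {w : Fin n → A} {z : A} (e : ℕ) :
    z ^ p ^ e ∈ Ideal.span (Set.range fun i => w i ^ p ^ e) ↔ z ∈ Ideal.span (Set.range w) := by
  refine ⟨fun h => ?_, fun h => pow_mem_span_range_pow p h e⟩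
  obtain ⟨c, hc⟩ := Ideal.mem_span_range_iff_exists_fun.1 h
  choose d hd using fun i => (bijective_iterateFrobenius A p e).2 (c i)
  refine Ideal.mem_span_range_iff_exists_fun.2 ⟨d, (bijective_iterateFrobenius A p e).1 ?_⟩
  simp only [iterateFrobenius_def] at hd ⊢
  rw [sum_pow_char_pow, ← hc]
  simp [mul_pow, hd]

lemma PerfectClosure.exists_pow_eq_of (z : PerfectClosure A p) :
    ∃ (e : ℕ) (a : A), z ^ p ^ e = PerfectClosure.of A p a := by
  induction z using PerfectClosure.induction_on with
  | h x =>
    refine ⟨x.1, x.2, ?_⟩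
    rw [PerfectClosure.mk_pow, PerfectClosure.of_apply, PerfectClosure.mk_eq_iff]
    exact ⟨0, by simp [← iterateFrobenius_def, coe_iterateFrobenius]⟩

lemma PerfectClosure.exists_pow_eq_of_fun {n : ℕ} (z : Fin n → PerfectClosure A p) :
    ∃ (e : ℕ) (a : Fin n → A), ∀ i, z i ^ p ^ e = PerfectClosure.of A p (a i) := by
  choose e a h using fun i => PerfectClosure.exists_pow_eq_of p (z i)
  refine ⟨Finset.univ.sup e, fun i => a i ^ p ^ (Finset.univ.sup e - e i), fun i => ?_⟩
  rw [map_pow, ← h, ← pow_mul, ← pow_add,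
    Nat.add_sub_cancel' (Finset.le_sup (f := e) (Finset.mem_univ i))]

lemma PerfectClosure.of_mem_span_range {n : ℕ} {w : Fin n → A} {a : A}
    (h : PerfectClosure.of A p a ∈ Ideal.span (Set.range (PerfectClosure.of A p ∘ w))) :
    ∃ e, a ^ p ^ e ∈ Ideal.span (Set.range fun i => w i ^ p ^ e) := by
  obtain ⟨c, hc⟩ := Ideal.mem_span_range_iff_exists_fun.1 h
  obtain ⟨e, d, hd⟩ := PerfectClosure.exists_pow_eq_of_fun p c
  have h₁ : PerfectClosure.of A p (∑ i, d i * w i ^ p ^ e) = PerfectClosure.of A p (a ^ p ^ e) := by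
    rw [map_pow, ← hc, sum_pow_char_pow, map_sum]
    simp [mul_pow, hd]
  rw [PerfectClosure.of_apply, PerfectClosure.of_apply, PerfectClosure.mk_eq_iff] at h₁
  obtain ⟨m, hm⟩ := h₁
  simp only [zero_add, ← coe_iterateFrobenius, iterateFrobenius_def] at hm
  refine ⟨e + m, ?_⟩
  rw [pow_add, pow_mul, ← hm, sum_pow_char_pow]
  exact Ideal.mem_span_range_iff_exists_fun.2 ⟨fun i => d i ^ p ^ m, by simp [mul_pow, ← pow_mul]⟩

lemma RegularVector.perfectClosure {n : ℕ} {y : Fin n → A} (h : RegularVector y) :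
    RegularVector (PerfectClosure.of A p ∘ y) := by
  intro k z hz
  obtain ⟨e, a, ha⟩ := PerfectClosure.exists_pow_eq_of p z
  rw [← map_truncate] at hz ⊢
  rw [← pow_mem_span_range_pow_iff p e]
  have h₁ := pow_mem_span_range_pow p hz e
  rw [mul_pow, ha, Function.comp, ← map_pow, ← map_mul] at h₁
  simp only [Function.comp, ← map_pow] at h₁
  obtain ⟨m, hm⟩ := PerfectClosure.of_mem_span_range p (w := fun i => truncate y k i ^ p ^ e) h₁
  have hp : p ≠ 0 := (Fact.out : p.Prime).ne_zero
  simp only [mul_pow, ← pow_mul, ← pow_add] at hm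
  rw [← truncate_pow _ _ (by positivity)] at hm
  have h₂ := h.pow (p ^ (e + m)) k _ hm
  rw [truncate_pow _ _ (by positivity)] at h₂
  rw [ha, ← pow_mem_span_range_pow_iff p m]
  obtain ⟨c, hc⟩ := Ideal.mem_span_range_iff_exists_fun.1 h₂
  rw [← map_pow, ← hc, map_sum]
  refine Ideal.mem_span_range_iff_exists_fun.2 ⟨fun i => PerfectClosure.of A p (c i), ?_⟩
  simp [← pow_mul, pow_add]

lemma PerfectClosure.one_notMem_span_range {n : ℕ} {y : Fin n → A}
    (h : (1 : A) ∉ Ideal.span (Set.range y)) :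
    (1 : PerfectClosure A p) ∉ Ideal.span (Set.range (PerfectClosure.of A p ∘ y)) := by
  intro h₁
  rw [← map_one (PerfectClosure.of A p)] at h₁
  obtain ⟨e, he⟩ := PerfectClosure.of_mem_span_range p h₁
  rw [one_pow] at he
  refine h (Ideal.span_le.2 ?_ he)
  rintro _ ⟨i, rfl⟩
  exact Ideal.pow_mem_of_mem _ (Ideal.subset_span (Set.mem_range_self i)) _
    (pow_pos (Fact.out : p.Prime).pos _)

end Perfect

lemma mem_span_range_pi {A X : Type*} [CommRing A] {n : ℕ} {v : Fin n → X → A} {f : X → A} :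
    f ∈ Ideal.span (Set.range v) ↔ ∀ x, f x ∈ Ideal.span (Set.range fun i => v i x) := by
  simp only [Ideal.mem_span_range_iff_exists_fun]
  refine ⟨?_, fun h => ?_⟩
  · rintro ⟨c, rfl⟩ x
    exact ⟨fun i => c i x, by simp⟩
  · choose c hc using h
    exact ⟨fun i x => c x i, by ext x; simp [hc]⟩

lemma span_range_pow_antitone {A : Type*} [CommRing A] {n : ℕ} (y : Fin n → A) :
    Antitone fun t : ℕ => Ideal.span (Set.range fun i => y i ^ t) := by
  intro s t hst
  refine Ideal.span_le.2 ?_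
  rintro _ ⟨i, rfl⟩
  exact Ideal.mem_of_dvd _ (pow_dvd_pow _ hst) (Ideal.subset_span (Set.mem_range_self i))

section Separation

open Filter

variable {A : Type*} [CommRing A] {n : ℕ}

/-- Sequences in `A` that converge to zero in the topology defined by the powers of `y`. -/
def nullSequences (y : Fin n → A) : Ideal (ℕ → A) where
  carrier := {f | ∀ t : ℕ, ∀ᶠ m in atTop, f m ∈ Ideal.span (Set.range fun i => y i ^ t)}
  zero_mem' t := by simp
  add_mem' hf hg t := by
    filter_upwards [hf t, hg t] with m h₁ h₂ using Ideal.add_mem _ h₁ h₂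
  smul_mem' c f hf t := by
    filter_upwards [hf t] with m h₁ using Ideal.mul_mem_left _ _ h₁

lemma mem_nullSequences {y : Fin n → A} {f : ℕ → A} : f ∈ nullSequences y ↔
    ∀ t : ℕ, ∀ᶠ m in atTop, f m ∈ Ideal.span (Set.range fun i => y i ^ t) := Iff.rfl

/-- The ring of sequences in `A` modulo those converging to zero. -/
abbrev SequenceRing (y : Fin n → A) : Type _ := (ℕ → A) ⧸ nullSequences y

/-- The map sending an element to the class of a constant sequence. -/
def SequenceRing.const (y : Fin n → A) : A →+* SequenceRing y :=
  (Ideal.Quotient.mk _).comp (Pi.constRingHom ℕ A)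

lemma SequenceRing.mk_mem_span_range_iff (y v : Fin n → A) (f : ℕ → A) :
    Ideal.Quotient.mk (nullSequences y) f ∈
        Ideal.span (Set.range (SequenceRing.const y ∘ v)) ↔
      ∀ t : ℕ, ∀ᶠ m in atTop,
        f m ∈ Ideal.span (Set.range v) ⊔ Ideal.span (Set.range fun i => y i ^ t) := by
  have h₀ : Ideal.span (Set.range (SequenceRing.const y ∘ v)) =
      (Ideal.span (Set.range (Pi.constRingHom ℕ A ∘ v))).map
        (Ideal.Quotient.mk (nullSequences y)) := by
    rw [Ideal.map_span, ← Set.range_comp]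
    rfl
  have h₁ : ∀ g : ℕ → A, g ∈ Ideal.span (Set.range (Pi.constRingHom ℕ A ∘ v)) ↔
      ∀ m, g m ∈ Ideal.span (Set.range v) := fun g => mem_span_range_pi
  rw [h₀, ← Ideal.mem_comap, Ideal.comap_map_of_surjective' _ Ideal.Quotient.mk_surjective,
    Ideal.mk_ker]
  refine ⟨fun h t => ?_, fun h => ?_⟩
  · obtain ⟨g, hg, z, hz, rfl⟩ := Submodule.mem_sup.1 h
    filter_upwards [mem_nullSequences.1 hz t] with m hm
    exact Submodule.add_mem_sup ((h₁ g).1 hg m) hm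
  · classical
    let P : ℕ → ℕ → Prop := fun m t =>
      f m ∈ Ideal.span (Set.range v) ⊔ Ideal.span (Set.range fun i => y i ^ t)
    have hP : ∀ m, ∃ a ∈ Ideal.span (Set.range v), ∃ b, (P m 0 → b ∈ Ideal.span (Set.range fun i =>
        y i ^ (Nat.findGreatest (P m) m))) ∧ a + b = f m := by
      intro m
      by_cases h₂ : P m 0
      · obtain ⟨a, ha, b, hb, hab⟩ :=
          Submodule.mem_sup.1 (Nat.findGreatest_spec (P := P m) (Nat.zero_le m) h₂)
        exact ⟨a, ha, b, fun _ => hb, hab⟩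
      · exact ⟨0, Ideal.zero_mem _, f m, fun h₃ => absurd h₃ h₂, zero_add _⟩
    choose a ha b hb hab using hP
    rw [← (funext hab : a + b = f)]
    refine Submodule.add_mem_sup ((h₁ a).2 ha) (mem_nullSequences.2 fun t => ?_)
    filter_upwards [h 0, h t, eventually_ge_atTop t] with m hm₀ hm htm
    exact span_range_pow_antitone y (Nat.le_findGreatest htm hm) (hb m hm₀)

lemma SequenceRing.mk_eq_zero_iff (y : Fin n → A) (f : ℕ → A) :
    Ideal.Quotient.mk (nullSequences y) f = 0 ↔
      ∀ t : ℕ, ∀ᶠ m in atTop, f m ∈ Ideal.span (Set.range fun i => y i ^ t) := by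
  rw [Ideal.Quotient.eq_zero_iff_mem, mem_nullSequences]

lemma RegularVector.sequenceRing {y : Fin n → A} (h : RegularVector y) :
    RegularVector (SequenceRing.const y ∘ y) := by
  intro k r hr
  obtain ⟨f, rfl⟩ := Ideal.Quotient.mk_surjective r
  rw [← map_truncate, SequenceRing.mk_mem_span_range_iff]
  have h₁ : SequenceRing.const y (y k) * Ideal.Quotient.mk (nullSequences y) f =
    Ideal.Quotient.mk (nullSequences y) (fun m => y k * f m) := rfl
  rw [← map_truncate, Function.comp, h₁, SequenceRing.mk_mem_span_range_iff] at hr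
  intro t
  filter_upwards [hr (t + 1)] with m hm using h.mem_sup_span_range_pow k t _ hm

lemma SequenceRing.eq_zero_of_forall_mem (y : Fin n → A) (z : SequenceRing y)
    (hz : ∀ t, z ∈ Ideal.span (Set.range fun i => SequenceRing.const y (y i) ^ t)) : z = 0 := by
  obtain ⟨f, rfl⟩ := Ideal.Quotient.mk_surjective z
  rw [SequenceRing.mk_eq_zero_iff]
  intro t
  have h₁ := hz t
  simp only [← map_pow] at h₁
  have h₂ := (SequenceRing.mk_mem_span_range_iff y (fun i => y i ^ t) f).1 h₁ t
  rwa [sup_idem] at h₂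

lemma SequenceRing.nontrivial {y : Fin n → A} (h : (1 : A) ∉ Ideal.span (Set.range y)) :
    Nontrivial (SequenceRing y) := by
  rw [Ideal.Quotient.nontrivial_iff, Ideal.ne_top_iff_one, mem_nullSequences]
  intro h₁
  obtain ⟨m, hm⟩ := (h₁ 1).exists
  exact h (by simpa using hm)

lemma SequenceRing.isReduced (p : ℕ) [Fact p.Prime] [CharP A p] [PerfectRing A p]
    (y : Fin n → A) : IsReduced (SequenceRing y) where
  eq_zero z hz := by
    obtain ⟨N, hN⟩ := hz
    obtain ⟨f, rfl⟩ := Ideal.Quotient.mk_surjective z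
    have h₁ := pow_eq_zero_of_le (Nat.lt_pow_self (Fact.out : p.Prime).one_lt).le hN
    rw [← map_pow, SequenceRing.mk_eq_zero_iff] at h₁
    rw [SequenceRing.mk_eq_zero_iff]
    intro t
    filter_upwards [h₁ (t * p ^ N)] with m hm
    simp only [pow_mul] at hm
    exact (pow_mem_span_range_pow_iff p N).1 hm

end Separation

/-- A regular vector in characteristic `p` maps to a regular vector in a reduced separated ring. -/
lemma RegularVector.exists_reduced_separated {A : Type*} [CommRing A] (p : ℕ) [Fact p.Prime]
    [CharP A p] {n : ℕ} {y : Fin n → A} (h : RegularVector y)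
    (h₁ : (1 : A) ∉ Ideal.span (Set.range y)) :
    ∃ (z : Fin n → PerfectClosure A p) (f : A →+* SequenceRing z), RegularVector (f ∘ y) ∧
      IsReduced (SequenceRing z) ∧ Nontrivial (SequenceRing z) ∧ ∀ b : SequenceRing z,
        (∀ t, b ∈ Ideal.span (Set.range fun i => f (y i) ^ t)) → b = 0 :=
  ⟨PerfectClosure.of A p ∘ y, (SequenceRing.const _).comp (PerfectClosure.of A p),
    (h.perfectClosure p).sequenceRing, SequenceRing.isReduced p _,
    SequenceRing.nontrivial (PerfectClosure.one_notMem_span_range p h₁),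
    SequenceRing.eq_zero_of_forall_mem _⟩

section GenericBasis

variable {A T : Type*} [CommRing A] [CommRing T] [Algebra A T]

/-- The scalar `c` kills all coefficients of linear relations between elements of `s`. -/
def KillsRelations (c : A) (s : Finset T) : Prop :=
  ∀ b : T → A, ∑ u ∈ s, b u • u = 0 → ∀ u ∈ s, c * b u = 0

lemma KillsRelations.mul {c : A} {s : Finset T} (h : KillsRelations c s) (a : A) :
    KillsRelations (c * a) s := fun b hb u hu => by
  rw [mul_right_comm, h b hb u hu, zero_mul]

/-- A finite extension of a reduced ring is generically free on a family containing `1`. -/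
lemma exists_killsRelations [IsReduced A] [Nontrivial A] [Module.Finite A T]
    (hinj : Function.Injective (algebraMap A T)) :
    ∃ (c : A) (s : Finset T), c ≠ 0 ∧ 1 ∈ s ∧ KillsRelations c s ∧
      ∀ t : T, c • t ∈ Submodule.span A (s : Set T) := by
  classical
  obtain ⟨G, hG⟩ := (Module.Finite.fg_top : (⊤ : Submodule A T).FG)
  have hne : ((insert 1 G).powerset.filter
      fun s => 1 ∈ s ∧ ∃ c : A, c ≠ 0 ∧ KillsRelations c s).Nonempty := by
    refine ⟨{1}, Finset.mem_filter.2 ⟨by simp, by simp, 1, one_ne_zero, fun b hb u hu => ?_⟩⟩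
    rw [Finset.mem_singleton] at hu
    subst hu
    rw [Finset.sum_singleton, ← Algebra.algebraMap_eq_smul_one] at hb
    rw [one_mul]
    exact hinj (by rw [hb, map_zero])
  obtain ⟨s, hs⟩ := Finset.exists_maximal hne
  obtain ⟨hsG, hs1, c₀, hc₀, hk₀⟩ := Finset.mem_filter.1 hs.1
  have key : ∀ H : Finset T, H ⊆ G → ∃ c : A, c ≠ 0 ∧ KillsRelations c s ∧
      ∀ h ∈ H, c • h ∈ Submodule.span A (s : Set T) := by
    intro H
    induction H using Finset.induction_on with
    | empty => exact fun _ => ⟨c₀, hc₀, hk₀, by simp⟩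
    | insert h H hH ih =>
      intro hHG
      obtain ⟨c, hc, hk, hspan⟩ := ih ((Finset.subset_insert _ _).trans hHG)
      by_cases hhs : h ∈ s
      · refine ⟨c, hc, hk, fun h' hh' => ?_⟩
        rcases Finset.mem_insert.1 hh' with rfl | hh'
        · exact Submodule.smul_mem _ _ (Submodule.subset_span hhs)
        · exact hspan _ hh'
      have hnot : ¬ KillsRelations c (insert h s) := fun hk' => by
        have := hs.2 (y := insert h s) (Finset.mem_filter.2 ⟨?_, by simp [hs1], c, hc, hk'⟩)
          (Finset.subset_insert _ _)
        · exact hhs (this (Finset.mem_insert_self _ _))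
        · rw [Finset.mem_powerset] at hsG ⊢
          exact Finset.insert_subset
            (Finset.mem_insert_of_mem (hHG (Finset.mem_insert_self _ _))) hsG
      unfold KillsRelations at hnot
      push Not at hnot
      obtain ⟨b, hb, u, hu, hbu⟩ := hnot
      rw [Finset.sum_insert hhs] at hb
      have hbh : c * b h ≠ 0 := by
        intro h0
        have h₁ : ∑ u ∈ s, (c * b u) • u = 0 := by
          have := congrArg (c • ·) hb
          simpa [smul_add, smul_smul, h0, Finset.smul_sum] using this
        rcases Finset.mem_insert.1 hu with rfl | hu
        · exact hbu h0
        · refine hbu (IsReduced.eq_zero _ ⟨2, ?_⟩)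
          linear_combination b u * hk _ h₁ u hu
      refine ⟨c * b h, hbh, hk.mul _, fun h' hh' => ?_⟩
      rcases Finset.mem_insert.1 hh' with rfl | hh'
      · rw [mul_smul, eq_neg_of_add_eq_zero_left hb]
        exact Submodule.smul_mem _ _ (Submodule.neg_mem _ (Submodule.sum_mem _ fun u hu =>
          Submodule.smul_mem _ _ (Submodule.subset_span hu)))
      · rw [mul_comm, mul_smul]
        exact Submodule.smul_mem _ _ (hspan _ hh')
  obtain ⟨c, hc, hk, hspan⟩ := key G subset_rfl
  refine ⟨c, s, hc, hs1, hk, fun t => ?_⟩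
  have : (⊤ : Submodule A T) ≤ (Submodule.span A (s : Set T)).comap (LinearMap.lsmul A T c) := by
    rw [← hG]
    exact Submodule.span_le.2 hspan
  exact this (Submodule.mem_top : t ∈ ⊤)

lemma exists_coeff_of_mem_map {c : A} {s : Finset T}
    (hspan : ∀ t : T, c • t ∈ Submodule.span A (s : Set T)) {I : Ideal A} {z : T}
    (hz : z ∈ I.map (algebraMap A T)) :
    ∃ b : T → A, (∀ u, b u ∈ I) ∧ c • z = ∑ u ∈ s, b u • u := by
  rw [← Submodule.restrictScalars_mem A, ← Ideal.smul_top_eq_map] at hz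
  refine Submodule.smul_induction_on hz (fun r hr t _ => ?_) ?_
  · obtain ⟨b, hb⟩ := Submodule.mem_span_finset'.1 (hspan t)
    classical
    refine ⟨fun u => if h : u ∈ s then r * b ⟨u, h⟩ else 0, fun u => ?_, ?_⟩
    · dsimp only
      split_ifs
      exacts [I.mul_mem_right _ hr, I.zero_mem]
    · rw [smul_comm, ← hb, Finset.smul_sum, ← Finset.sum_coe_sort s]
      exact Finset.sum_congr rfl fun u _ => by simp [mul_smul]
  · rintro x y ⟨b, hb, hx⟩ ⟨d, hd, hy⟩
    exact ⟨b + d, fun u => I.add_mem (hb u) (hd u), by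
      simp [smul_add, hx, hy, add_smul, Finset.sum_add_distrib]⟩

/-- A finite extension of a reduced ring has a nonzero uniform colon-killer whose powers can be
tested for membership in ideals of the base. -/
lemma exists_colonKiller [IsReduced A] [Nontrivial A] [Module.Finite A T]
    (hinj : Function.Injective (algebraMap A T)) :
    ∃ c : A, c ≠ 0 ∧
      (∀ (I : Ideal A) (x : A), (∀ r, x * r ∈ I → r ∈ I) → ∀ r : T,
        algebraMap A T x * r ∈ I.map (algebraMap A T) →
          algebraMap A T c * r ∈ I.map (algebraMap A T)) ∧
      ∀ (I : Ideal A) (N : ℕ), algebraMap A T c ^ N ∈ I.map (algebraMap A T) →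
        c ^ (N + 1) ∈ I := by
  classical
  obtain ⟨c, s, hc, hs, hk, hspan⟩ := exists_killsRelations hinj
  refine ⟨c ^ 2, fun h => hc (IsReduced.eq_zero _ ⟨2, h⟩), fun I x hx r hr => ?_,
    fun I N h => ?_⟩
  · obtain ⟨b, hb, hbr⟩ := exists_coeff_of_mem_map hspan hr
    obtain ⟨a, -, har⟩ := exists_coeff_of_mem_map (I := ⊤) hspan (z := r) (by simp [Ideal.map_top])
    have h₁ : ∑ u ∈ s, (x * a u - b u) • u = 0 := by
      simp only [sub_smul, Finset.sum_sub_distrib, mul_smul, ← Finset.smul_sum, ← har, ← hbr]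
      rw [← Algebra.smul_def, smul_comm, sub_self]
    have h₂ : ∀ u ∈ s, c * a u ∈ I := fun u hu => hx _ <| by
      rw [show x * (c * a u) = c * b u by linear_combination hk _ h₁ u hu]
      exact I.mul_mem_left _ (hb u)
    rw [← Algebra.smul_def, pow_two, mul_smul, har, Finset.smul_sum]
    refine Ideal.sum_mem _ fun u hu => ?_
    rw [smul_smul, Algebra.smul_def]
    exact Ideal.mul_mem_right _ _ (Ideal.mem_map_of_mem _ (h₂ u hu))
  · rw [← map_pow] at h
    obtain ⟨b, hb, hbr⟩ := exists_coeff_of_mem_map hspan h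
    have h₁ : ∑ u ∈ s, ((if u = 1 then c * (c ^ 2) ^ N else 0) - b u) • u = 0 := by
      simp only [sub_smul, Finset.sum_sub_distrib, ite_smul, zero_smul, Finset.sum_ite_eq', hs,
        if_true, ← hbr]
      rw [mul_smul, ← Algebra.algebraMap_eq_smul_one, sub_self]
    have h₂ := hk _ h₁ 1 hs
    rw [if_pos rfl] at h₂
    rw [show (c ^ 2) ^ (N + 1) = c * b 1 by linear_combination h₂]
    exact I.mul_mem_left _ (hb 1)

end GenericBasis

section AlmostLocalization

open Filter

variable {A T : Type*} [CommRing A] [CommRing T] [Algebra A T]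

/-- Functions on pairs of a finite subset `F` of `T` and an exponent that eventually take values in
the subalgebra generated by `F`. -/
def eventuallyAdjoin (A T : Type*) [CommRing A] [CommRing T] [Algebra A T] :
    Subring (Finset T × ℕ → T) where
  carrier := {f | ∀ᶠ x in atTop ×ˢ atTop, f x ∈ Algebra.adjoin A (x.1 : Set T)}
  mul_mem' {_ _} hf hg := by
    rw [Set.mem_ofPred_eq] at hf hg ⊢
    filter_upwards [hf, hg] with _ h₁ h₂ using mul_mem h₁ h₂
  one_mem' := by
    rw [Set.mem_ofPred_eq]
    exact .of_forall fun _ => one_mem _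
  add_mem' {_ _} hf hg := by
    rw [Set.mem_ofPred_eq] at hf hg ⊢
    filter_upwards [hf, hg] with _ h₁ h₂ using add_mem h₁ h₂
  zero_mem' := by
    rw [Set.mem_ofPred_eq]
    exact .of_forall fun _ => zero_mem _
  neg_mem' {_} hf := by
    rw [Set.mem_ofPred_eq] at hf ⊢
    filter_upwards [hf] with _ h using neg_mem h

lemma mem_eventuallyAdjoin {f : Finset T × ℕ → T} : f ∈ eventuallyAdjoin A T ↔
    ∀ᶠ x in atTop ×ˢ atTop, f x ∈ Algebra.adjoin A (x.1 : Set T) := Iff.rfl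

/-- Elements of `eventuallyAdjoin A T` that eventually agree with a power of `c`. -/
def eventuallyPowers (c : Finset T → A) : Submonoid (eventuallyAdjoin A T) where
  carrier := {f | ∃ N : ℕ, ∀ᶠ x in atTop ×ˢ atTop, f.1 x = algebraMap A T (c x.1) ^ N}
  mul_mem' := by
    rintro f g ⟨N, hf⟩ ⟨M, hg⟩
    refine ⟨N + M, hf.mp (hg.mono fun x h₁ h₂ => ?_)⟩
    rw [pow_add, ← h₁, ← h₂]
    rfl
  one_mem' := ⟨0, Eventually.of_forall fun _ => by simp⟩

/-- The localization of `eventuallyAdjoin A T` at the eventual powers of `c`. -/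
abbrev AlmostLocalization (c : Finset T → A) : Type _ := Localization (eventuallyPowers c)

variable (A T) in
/-- The ring homomorphism sending `t` to the family of its Frobenius iterates. -/
def frobeniusFamily (p : ℕ) [Fact p.Prime] [CharP T p] : T →+* eventuallyAdjoin A T :=
  (RingHom.pi fun x : Finset T × ℕ => iterateFrobenius T p x.2).codRestrict _ fun t => by
    rw [mem_eventuallyAdjoin]
    filter_upwards [tendsto_fst.eventually (eventually_ge_atTop {t})] with x hx
    exact pow_mem (Algebra.subset_adjoin (by simpa using hx)) _

lemma frobeniusFamily_apply (p : ℕ) [Fact p.Prime] [CharP T p] (t : T) (x : Finset T × ℕ) :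
    (frobeniusFamily A T p t).1 x = t ^ p ^ x.2 := rfl

variable (T) in
/-- The image of a vector of `A` in the ring `eventuallyAdjoin A T`, via Frobenius iterates. -/
def frobeniusVector (p : ℕ) [Fact p.Prime] [CharP T p] {n : ℕ} (v : Fin n → A) :
    Fin n → eventuallyAdjoin A T :=
  frobeniusFamily A T p ∘ algebraMap A T ∘ v

/-- The ideal generated by a power of a vector, extended to a subalgebra of finite type. -/
abbrev adjoinPowerIdeal (p : ℕ) {n : ℕ} (v : Fin n → A) (x : Finset T × ℕ) :
    Ideal (Algebra.adjoin A (x.1 : Set T)) :=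
  (Ideal.span (Set.range fun i => v i ^ p ^ x.2)).map (algebraMap A _)

lemma mem_adjoinPowerIdeal (p : ℕ) {n : ℕ} (v : Fin n → A) (x : Finset T × ℕ)
    (t : Algebra.adjoin A (x.1 : Set T)) : t ∈ adjoinPowerIdeal p v x ↔
      ∃ d : Fin n → T, (∀ i, d i ∈ Algebra.adjoin A (x.1 : Set T)) ∧
        ∑ i, d i * algebraMap A T (v i) ^ p ^ x.2 = t := by
  rw [adjoinPowerIdeal, Ideal.map_span, ← Set.range_comp, Ideal.mem_span_range_iff_exists_fun]
  constructor
  · rintro ⟨d, rfl⟩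
    exact ⟨fun i => d i, fun i => (d i).2, by simp⟩
  · rintro ⟨d, hd, h⟩
    exact ⟨fun i => ⟨d i, hd i⟩, Subtype.ext (by simp [← h])⟩

lemma AlmostLocalization.algebraMap_mem_span_range_iff (p : ℕ) [Fact p.Prime] [CharP T p]
    (c : Finset T → A) {n : ℕ} (v : Fin n → A) (w : eventuallyAdjoin A T) :
    algebraMap _ (AlmostLocalization c) w ∈
        Ideal.span (Set.range (algebraMap _ (AlmostLocalization c) ∘ frobeniusVector T p v)) ↔
      ∃ N : ℕ, ∀ᶠ x in atTop ×ˢ atTop, ∃ t ∈ adjoinPowerIdeal p v x,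
        (t : T) = algebraMap A T (c x.1) ^ N * w.1 x := by
  rw [Set.range_comp, ← Ideal.map_span,
    IsLocalization.algebraMap_mem_map_algebraMap_iff (eventuallyPowers c)]
  simp only [Ideal.mem_span_range_iff_exists_fun]
  constructor
  · rintro ⟨m, ⟨N, hN⟩, d, hd⟩
    refine ⟨N, ?_⟩
    have h₁ := eventually_all.2 fun i => mem_eventuallyAdjoin.1 (d i).2
    filter_upwards [hN, h₁, mem_eventuallyAdjoin.1 (m * w).2] with x hx hdx hmw
    refine ⟨⟨_, hmw⟩, (mem_adjoinPowerIdeal p v x _).2 ⟨fun i => (d i).1 x, hdx, ?_⟩, ?_⟩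
    · simp [← hd, frobeniusVector, frobeniusFamily_apply]
    · rw [← hx]
      rfl
  · rintro ⟨N, hN⟩
    classical
    let P : Finset T × ℕ → (Fin n → T) → Prop := fun x d =>
      (∀ i, d i ∈ Algebra.adjoin A (x.1 : Set T)) ∧
        ∑ i, d i * algebraMap A T (v i) ^ p ^ x.2 = algebraMap A T (c x.1) ^ N * w.1 x
    have hP : ∀ᶠ x in atTop ×ˢ atTop, ∃ d, P x d := by
      filter_upwards [hN] with x ⟨t, ht, hx⟩
      rw [mem_adjoinPowerIdeal, hx] at ht
      exact ht
    let D : Finset T × ℕ → Fin n → T := fun x => if h : ∃ d, P x d then h.choose else 0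
    have hD : ∀ x, (∃ d, P x d) → P x (D x) := fun x h => by
      simp only [D, dif_pos h]
      exact h.choose_spec
    let m : eventuallyAdjoin A T :=
      ⟨fun x => if ∃ d, P x d then algebraMap A T (c x.1) ^ N else 0,
        mem_eventuallyAdjoin.2 <| .of_forall fun x => by
        split_ifs
        exacts [pow_mem (Subalgebra.algebraMap_mem _ _) _, zero_mem _]⟩
    refine ⟨m, ⟨N, ?_⟩, fun i => ⟨fun x => D x i, ?_⟩, ?_⟩
    · filter_upwards [hP] with x hx using if_pos hx
    · rw [mem_eventuallyAdjoin]
      filter_upwards [hP] with x hx using (hD x hx).1 i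
    · ext x : 2
      simp only [frobeniusVector, AddSubmonoidClass.coe_finsetSum, Subring.coe_mul,
        Finset.sum_apply, Pi.mul_apply, Function.comp, frobeniusFamily_apply, m]
      split_ifs with h
      · exact (hD x h).2
      · simp [D, dif_neg h]

end AlmostLocalization

lemma exists_regularVector_of_isIntegral {A T : Type*} [CommRing A] [CommRing T] [Algebra A T]
    [IsReduced A] [Nontrivial A] [Algebra.IsIntegral A T]
    (hinj : Function.Injective (algebraMap A T)) (p : ℕ) [Fact p.Prime] [CharP T p]
    {n : ℕ} {y : Fin n → A} (hy : RegularVector y)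
    (hsep : ∀ b : A, (∀ t, b ∈ Ideal.span (Set.range fun i => y i ^ t)) → b = 0) :
    ∃ (c : Finset T → A) (f : T →+* AlmostLocalization c),
      RegularVector (f ∘ algebraMap A T ∘ y) ∧
      1 ∉ Ideal.span (Set.range (f ∘ algebraMap A T ∘ y)) := by
  have hp : p.Prime := Fact.out
  have hfin : ∀ F : Finset T, Module.Finite A (Algebra.adjoin A (F : Set T)) := fun F =>
    Algebra.finite_adjoin_of_finite_of_isIntegral F.finite_toSet
      fun t _ => Algebra.IsIntegral.isIntegral t
  have hinj' : ∀ F : Finset T,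
      Function.Injective (algebraMap A (Algebra.adjoin A (F : Set T))) := fun F a b h =>
    hinj congr(($h : T))
  choose c hc hcolon hpow using fun F : Finset T => exists_colonKiller (hinj' F)
  refine ⟨c, (algebraMap _ _).comp (frobeniusFamily A T p), fun k r hr => ?_, fun h => ?_⟩
  · have hY : ∀ v : Fin n → A, ((algebraMap _ (AlmostLocalization c)).comp
        (frobeniusFamily A T p)) ∘ algebraMap A T ∘ v =
        algebraMap _ (AlmostLocalization c) ∘ frobeniusVector T p v := fun _ => rfl
    rw [← map_truncate, ← map_truncate, hY] at hr ⊢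
    obtain ⟨w, m, rfl⟩ := IsLocalization.exists_mk'_eq (eventuallyPowers c) r
    have hmul := Ideal.mul_mem_right (algebraMap _ (AlmostLocalization c) m.1) _ hr
    rw [mul_assoc, IsLocalization.mk'_spec, Function.comp, RingHom.comp_apply, ← map_mul,
      AlmostLocalization.algebraMap_mem_span_range_iff] at hmul
    obtain ⟨N, hN⟩ := hmul
    rw [IsLocalization.mk'_eq_mul_mk'_one]
    refine Ideal.mul_mem_right _ _
      ((AlmostLocalization.algebraMap_mem_span_range_iff p c _ w).2 ⟨N + 1, ?_⟩)
    filter_upwards [hN, mem_eventuallyAdjoin.1 w.2] with ⟨F, e⟩ ⟨t, ht, htw⟩ hw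
    have hq : p ^ e ≠ 0 := pow_ne_zero _ hp.ne_zero
    have hcol := hcolon F (Ideal.span (Set.range fun i => truncate y k i ^ p ^ e)) (y k ^ p ^ e)
      (by simpa only [truncate_pow _ _ hq] using hy.pow (p ^ e) k)
      (algebraMap A _ (c F) ^ N * ⟨w.1 (F, e), hw⟩) (by
        convert ht
        refine Subtype.ext ?_
        simp [htw, frobeniusFamily_apply]
        ring)
    refine ⟨_, hcol, ?_⟩
    simp
    ring
  · have h₁ := (AlmostLocalization.algebraMap_mem_span_range_iff p c y 1).1 (by rwa [map_one])
    obtain ⟨N, hN⟩ := h₁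
    obtain ⟨F, hF⟩ := hN.curry.exists
    have h₂ : c F ^ (N + 1) = 0 := hsep _ fun t => by
      obtain ⟨e, ⟨s, hs, hse⟩, hte⟩ := (hF.and (Filter.eventually_ge_atTop t)).exists
      refine span_range_pow_antitone y (hte.trans (Nat.lt_pow_self hp.one_lt).le) (hpow F _ N ?_)
      convert hs
      exact Subtype.ext (by simp [hse])
    exact hc F (IsReduced.eq_zero _ ⟨_, h₂⟩)

lemma exists_ringHom_extension_of_isIntegral {S T Ω : Type*} [CommRing S] [CommRing T]
    [Algebra S T] [Algebra.IsIntegral S T] (hinj : Function.Injective (algebraMap S T))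
    [Field Ω] [IsAlgClosed Ω] (g : S →+* Ω) : ∃ h : T →+* Ω, h.comp (algebraMap S T) = g := by
  obtain ⟨P, hP⟩ : ∃ P, P = RingHom.ker g := ⟨_, rfl⟩
  have : P.IsPrime := hP ▸ RingHom.ker_isPrime g
  obtain ⟨Q, -, hQ, hQP⟩ := Ideal.exists_ideal_over_prime_of_isIntegral P
    (⊥ : Ideal T) (by simp [Ideal.comap_bot_of_injective _ hinj])
  have : Q.LiesOver P := ⟨hQP.symm⟩
  let := (Ideal.Quotient.lift P g fun a ha => by rwa [hP] at ha).toAlgebra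
  have : FaithfulSMul (S ⧸ P) Ω := (faithfulSMul_iff_algebraMap_injective _ _).2
    (RingHom.lift_injective_of_ker_le_ideal P _ hP.ge)
  have : Module.IsTorsionFree (S ⧸ P) (T ⧸ Q) :=
    Module.isTorsionFree_iff_faithfulSMul.2 (Ideal.Quotient.instFaithfulSMul Q P)
  let h : T ⧸ Q →ₐ[S ⧸ P] Ω := IsAlgClosed.lift
  refine ⟨h.toRingHom.comp (Ideal.Quotient.mk Q), RingHom.ext fun s => ?_⟩
  exact h.commutes (Ideal.Quotient.mk P s)

open TensorProduct in
lemma includeLeft_injective_of_isIntegral {S B T : Type*} [CommRing S] [CommRing T] [CommRing B]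
    [Algebra S T] [Algebra S B] [Algebra.IsIntegral S T] [IsReduced B]
    (hinj : Function.Injective (algebraMap S T)) :
    Function.Injective (algebraMap B (B ⊗[S] T)) := by
  rw [injective_iff_map_eq_zero]
  refine fun b hb => IsReduced.eq_zero b (nilpotent_iff_mem_prime.2 fun P hP => ?_)
  let κ := AlgebraicClosure P.ResidueField
  let φ : B →+* κ := (algebraMap P.ResidueField κ).comp (algebraMap B P.ResidueField)
  obtain ⟨h, hh⟩ := exists_ringHom_extension_of_isIntegral hinj (φ.comp (algebraMap S B))
  let := (φ.comp (algebraMap S B)).toAlgebra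
  let φ' : B →ₐ[S] κ := { φ with commutes' := fun s => rfl }
  let h' : T →ₐ[S] κ := { h with commutes' := fun s => congr($hh s) }
  have h₀ : φ b = 0 := by
    have := congr(Algebra.TensorProduct.productMap φ' h' $hb)
    simpa [φ', Algebra.TensorProduct.algebraMap_apply] using this
  have h₁ : algebraMap B P.ResidueField b = 0 :=
    (algebraMap P.ResidueField κ).injective (by simpa [φ] using h₀)
  rwa [Ideal.algebraMap_residueField_eq_zero] at h₁

lemma exists_regularVector_of_isReduced {S : Type u} {T : Type v} {C : Type w} [CommRing S]
    [CommRing T] [CommRing C] [Algebra S T] [Algebra.IsIntegral S T]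
    (hinj : Function.Injective (algebraMap S T)) [IsReduced C] [Nontrivial C] (p : ℕ)
    [Fact p.Prime] [CharP C p] (f : S →+* C) {n : ℕ} {y : Fin n → S} (hy : RegularVector (f ∘ y))
    (hsep : ∀ b : C, (∀ t, b ∈ Ideal.span (Set.range fun i => f (y i) ^ t)) → b = 0) :
    ∃ (D : Type (max v w)) (_ : CommRing D) (g : T →+* D),
      RegularVector (g ∘ algebraMap S T ∘ y) ∧
      1 ∉ Ideal.span (Set.range (g ∘ algebraMap S T ∘ y)) := by
  let := f.toAlgebra
  have hinj' : Function.Injective (algebraMap C (TensorProduct S C T)) :=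
    includeLeft_injective_of_isIntegral hinj
  have : CharP (TensorProduct S C T) p := charP_of_injective_algebraMap hinj' p
  obtain ⟨c, g, hg, hg₁⟩ := exists_regularVector_of_isIntegral hinj' p hy hsep
  let ι : T →ₐ[S] TensorProduct S C T := Algebra.TensorProduct.includeRight
  have hcomp : g.comp ι.toRingHom ∘ algebraMap S T ∘ y =
      g ∘ algebraMap C (TensorProduct S C T) ∘ f ∘ y :=
    funext fun i => congrArg g (ι.commutes (y i))
  rw [← hcomp] at hg hg₁
  exact ⟨_, inferInstance, _, hg, hg₁⟩

section SmallSubring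

/-- Terms in the language of rings with unary operations indexed by `ι` and constants in `T`. -/
inductive OperationTerm (T : Type w) (ι : Type) : Type w
  | const (t : T) : OperationTerm T ι
  | add (a b : OperationTerm T ι) : OperationTerm T ι
  | mul (a b : OperationTerm T ι) : OperationTerm T ι
  | neg (a : OperationTerm T ι) : OperationTerm T ι
  | apply (i : ι) (a : OperationTerm T ι) : OperationTerm T ι

/-- The value of a term in a ring. -/
def OperationTerm.eval {T : Type w} {ι : Type} {C : Type v} [Ring C] (g : T → C)
    (ω : ι → C → C) : OperationTerm T ι → C
  | const t => g t
  | add a b => a.eval g ω + b.eval g ω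
  | mul a b => a.eval g ω * b.eval g ω
  | neg a => -a.eval g ω
  | apply i a => ω i (a.eval g ω)

lemma Subring.exists_small_of_operations {T : Type w} [Ring T] {ι : Type} {C : Type v} [Ring C] (g : T →+* C)
    (ω : ι → C → C) : ∃ A : Subring C, Small.{w} A ∧ (∀ t, g t ∈ A) ∧
      ∀ i, ∀ a ∈ A, ω i a ∈ A := by
  refine ⟨{ carrier := Set.range (OperationTerm.eval g ω)
            mul_mem' := ?_, one_mem' := ?_, add_mem' := ?_, zero_mem' := ?_, neg_mem' := ?_ },
    small_range _, fun t => ⟨.const t, rfl⟩, ?_⟩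
  · rintro _ _ ⟨a, rfl⟩ ⟨b, rfl⟩
    exact ⟨a.mul b, rfl⟩
  · exact ⟨.const 1, map_one g⟩
  · rintro _ _ ⟨a, rfl⟩ ⟨b, rfl⟩
    exact ⟨a.add b, rfl⟩
  · exact ⟨.const 0, map_zero g⟩
  · rintro _ ⟨a, rfl⟩
    exact ⟨a.neg, rfl⟩
  · rintro i _ ⟨a, rfl⟩
    exact ⟨a.apply i, rfl⟩

lemma RingEquiv.mem_span_range_comp_iff {A B ι : Type*} [CommRing A] [CommRing B] (e : A ≃+* B)
    (v : ι → A) (r : B) :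
    r ∈ Ideal.span (Set.range (e ∘ v)) ↔ e.symm r ∈ Ideal.span (Set.range v) := by
  rw [Set.range_comp, ← Ideal.map_span, ← Ideal.comap_symm, Ideal.mem_comap]

lemma RegularVector.map_ringEquiv {A B : Type*} [CommRing A] [CommRing B] (e : A ≃+* B) {n : ℕ}
    {y : Fin n → A} (h : RegularVector y) : RegularVector (e ∘ y) := by
  intro k r
  rw [← RingEquiv.coe_toRingHom e, ← map_truncate, RingEquiv.coe_toRingHom,
    e.mem_span_range_comp_iff, e.mem_span_range_comp_iff]
  simpa using h k (e.symm r)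

lemma RegularVector.exists_small_subring {T : Type w} [CommRing T] {C : Type v} [CommRing C]
    (g : T →+* C) {n : ℕ} (y : Fin n → T) (hy : RegularVector (g ∘ y))
    (h₁ : 1 ∉ Ideal.span (Set.range (g ∘ y))) :
    ∃ A : Subring C, Small.{w} A ∧ ∃ f : T →+* A,
      RegularVector (f ∘ y) ∧ 1 ∉ Ideal.span (Set.range (f ∘ y)) := by
  classical
  let P : Fin n → C → (Fin n → C) → Prop := fun k r s => ∑ i, s i * truncate (g ∘ y) k i = r
  obtain ⟨A, hA, hgA, hωA⟩ := Subring.exists_small_of_operations g fun (ki : Fin n × Fin n) r =>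
    if h : ∃ s, P ki.1 r s then h.choose ki.2 else 0
  let gA : T →+* A := g.codRestrict A hgA
  have hgA' : A.subtype ∘ gA ∘ y = g ∘ y := rfl
  have hreg : RegularVector (gA ∘ y) := fun k r hr => by
    have hr' := Ideal.mem_map_of_mem A.subtype hr
    rw [Ideal.map_span, ← Set.range_comp, map_truncate, hgA', map_mul] at hr'
    have h := Ideal.mem_span_range_iff_exists_fun.1 (hy k r hr')
    refine Ideal.mem_span_range_iff_exists_fun.2 ⟨fun i => ⟨h.choose i, ?_⟩, Subtype.ext ?_⟩
    · have := hωA (k, i) r r.2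
      rwa [dif_pos h] at this
    · refine Eq.trans ?_ h.choose_spec
      have htr : ∀ i, truncate (g ∘ y) k i = (truncate (gA ∘ y) k i : A) :=
        fun i => (congrFun (map_truncate A.subtype (gA ∘ y) k) i).symm
      simp [htr]
  refine ⟨A, hA, gA, hreg, fun h => h₁ ?_⟩
  have := Ideal.mem_map_of_mem A.subtype h
  rwa [Ideal.map_span, ← Set.range_comp, hgA', map_one] at this

lemma RegularVector.exists_small {T : Type w} [CommRing T] {C : Type v} [CommRing C]
    (g : T →+* C) {n : ℕ} (y : Fin n → T) (hy : RegularVector (g ∘ y))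
    (h₁ : 1 ∉ Ideal.span (Set.range (g ∘ y))) :
    ∃ (C' : Type (max u w)) (_ : CommRing C') (f : T →+* C'),
      RegularVector (f ∘ y) ∧ 1 ∉ Ideal.span (Set.range (f ∘ y)) := by
  obtain ⟨A, hA, f, hf, hone⟩ := hy.exists_small_subring g y h₁
  have : Small.{max u w} A := small_lift A
  let e := (Shrink.ringEquiv.{max u w} A).symm
  have hcomp : ((e : A →+* _).comp f) ∘ y = e ∘ f ∘ y := rfl
  refine ⟨Shrink.{max u w} A, inferInstance, (e : A →+* _).comp f, ?_, fun h => hone ?_⟩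
  · exact hcomp ▸ hf.map_ringEquiv e
  · rw [hcomp, e.mem_span_range_comp_iff, map_one] at h
    exact h

end SmallSubring

/-- **Theorem (Dietz, Thm. 4.2 / `intseed`).** Let `(R,m)` be a Noetherian local ring of
positive prime characteristic `p`. If `S` is a seed over `R` and `T` is an `R`-algebra
containing `S` such that `T` is integral over `S`, then `T` is a seed over `R`. -/
theorem seed_of_integral_extension
    (R : Type u) [CommRing R] [IsLocalRing R] [IsNoetherianRing R]
    (p : ℕ) [Fact p.Prime] [CharP R p]
    (S : Type v) [CommRing S] [Algebra R S]
    (T : Type w) [CommRing T] [Algebra R T] [Algebra S T] [IsScalarTower R S T]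
    (hST : Function.Injective (algebraMap S T))
    [Algebra.IsIntegral S T]
    (hS : IsSeed R S) : IsSeed R T := by
  have hp : p.Prime := Fact.out
  obtain ⟨B, _, _, ⟨⟨n, x, hx, hreg⟩, -⟩, ⟨φ⟩⟩ := hS
  obtain ⟨hy, h₁⟩ := (isRegular_ofFn_iff x).1 hreg
  have : Nontrivial B := nontrivial_of_ne 1 0 fun h => h₁ (h ▸ zero_mem _)
  have : CharP B p := (CharP.charP_iff_prime_eq_zero hp).2 <| by
    rw [← map_natCast (algebraMap R B), CharP.cast_eq_zero, map_zero]
  obtain ⟨z, f, hfy, _, _, hsep⟩ := hy.exists_reduced_separated p h₁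
  have hφ : algebraMap R B ∘ x = φ ∘ algebraMap R S ∘ x := funext fun i => (φ.commutes (x i)).symm
  have hT : algebraMap R T ∘ x = algebraMap S T ∘ algebraMap R S ∘ x :=
    funext fun i => IsScalarTower.algebraMap_apply R S T (x i)
  rw [hφ] at hfy hsep
  have : CharP (SequenceRing z) p := (CharP.charP_iff_prime_eq_zero hp).2 <| by
    rw [← map_natCast f, CharP.cast_eq_zero, map_zero]
  obtain ⟨D, _, g, hg, hg₁⟩ :=
    exists_regularVector_of_isReduced hST p (f.comp φ.toRingHom) hfy hsep
  rw [← hT] at hg hg₁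
  obtain ⟨C, _, h, hh, hh₁⟩ := hg.exists_small.{u} g _ hg₁
  let := (h.comp (algebraMap R T)).toAlgebra
  refine ⟨C, inferInstance, inferInstance,
    ⟨⟨n, x, hx, (isRegular_ofFn_iff x).2 ⟨hh, hh₁⟩⟩, fun htop => hh₁ ?_⟩,
    ⟨{ h with commutes' := fun r => rfl }⟩⟩
  have hle := Ideal.map_radical_le (I := Ideal.span (Set.range x)) (algebraMap R C)
  rw [hx.2.2, htop, top_le_iff, Ideal.radical_eq_top, Ideal.map_span, ← Set.range_comp,
    Ideal.eq_top_iff_one] at hle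
  exact hle
end

section
/- Let (R,m) be a complete Noetherian local domain of positive prime characteristic p. If S and S' are seeds over R, then S ⊗_R S' is a seed over R. Consequently, if B and B' are big Cohen-Macaulay R-algebras, then there exist a balanced big Cohen-Macaulay R-algebra C and R-algebra homomorphisms B → C and B' → C. -/
open IsLocalRing

universe u v w

/-- The ideal generated by the powers `y j ^ n j` for `j ∈ s`. -/
def powIdeal {T ι : Type*} [CommRing T] (y : ι → T) (s : Finset ι) (n : ι → ℕ) : Ideal T :=
  Ideal.span ((fun j => y j ^ n j) '' s)

/-- Every `y i` with `i ∈ s` is regular modulo any powers of the other members of the family. -/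
def IsStronglyReg {T ι : Type*} [CommRing T] [DecidableEq ι] (y : ι → T) (s : Finset ι) : Prop :=
  ∀ n : ι → ℕ, ∀ i ∈ s, ∀ a, y i ^ n i * a ∈ powIdeal y (s.erase i) n →
    a ∈ powIdeal y (s.erase i) n

/-- The colon property `(y ^ (n + e i)) : y i = (y ^ n)` for the full family `y`. -/
def IsGood {T ι : Type*} [CommRing T] [Fintype ι] [DecidableEq ι] (y : ι → T) : Prop :=
  ∀ (n : ι → ℕ) (i : ι) (u : T), y i * u ∈ powIdeal y Finset.univ (Function.update n i (n i + 1)) →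
    u ∈ powIdeal y Finset.univ n

section Good

variable {T ι : Type*} [CommRing T] {y : ι → T}

lemma pow_mem_powIdeal {s : Finset ι} (n : ι → ℕ) {j : ι} (hj : j ∈ s) :
    y j ^ n j ∈ powIdeal y s n :=
  Ideal.subset_span ⟨j, hj, rfl⟩

lemma powIdeal_le {s : Finset ι} {n : ι → ℕ} {I : Ideal T} :
    powIdeal y s n ≤ I ↔ ∀ j ∈ s, y j ^ n j ∈ I := by
  simp only [powIdeal, Ideal.span_le, Set.image_subset_iff]; rfl

lemma powIdeal_mono {s t : Finset ι} {n k : ι → ℕ} (hst : s ⊆ t) (h : ∀ j ∈ s, k j ≤ n j) :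
    powIdeal y s n ≤ powIdeal y t k :=
  powIdeal_le.2 fun j hj => Ideal.pow_mem_of_pow_mem _ (pow_mem_powIdeal k (hst hj)) (h j hj)

lemma powIdeal_congr {y' : ι → T} {s : Finset ι} {n k : ι → ℕ} (hy : ∀ j ∈ s, y j = y' j)
    (h : ∀ j ∈ s, n j = k j) : powIdeal y s n = powIdeal y' s k := by
  unfold powIdeal
  congr 1
  exact Set.image_congr fun j hj => by rw [hy j hj, h j hj]

variable [DecidableEq ι]

lemma powIdeal_insert (s : Finset ι) (n : ι → ℕ) (d : ι) :
    powIdeal y (insert d s) n = Ideal.span {y d ^ n d} ⊔ powIdeal y s n := by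
  simp only [powIdeal, Finset.coe_insert, Set.image_insert_eq, Ideal.span_insert]

lemma mem_powIdeal_insert {s : Finset ι} {n : ι → ℕ} {d : ι} {u : T} :
    u ∈ powIdeal y (insert d s) n ↔ ∃ c, u - y d ^ n d * c ∈ powIdeal y s n := by
  rw [powIdeal_insert, Ideal.mem_span_singleton_sup]
  constructor
  · rintro ⟨a, b, hb, rfl⟩
    exact ⟨a, by simpa [mul_comm] using hb⟩
  · rintro ⟨c, hc⟩
    exact ⟨c, _, hc, by ring⟩

lemma mem_powIdeal_of_mem {s : Finset ι} {n : ι → ℕ} {i : ι} (hi : i ∈ s) {u : T} :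
    u ∈ powIdeal y s n ↔ ∃ c, u - y i ^ n i * c ∈ powIdeal y (s.erase i) n := by
  rw [← mem_powIdeal_insert, Finset.insert_erase hi]

lemma IsStronglyReg.congr {y' : ι → T} {s : Finset ι} (h : IsStronglyReg y s)
    (hy : ∀ j ∈ s, y j = y' j) : IsStronglyReg y' s := by
  intro n i hi a ha
  have e : powIdeal y (s.erase i) n = powIdeal y' (s.erase i) n :=
    powIdeal_congr (fun j hj => hy j (Finset.mem_of_mem_erase hj)) fun _ _ => rfl
  rw [← e] at ha ⊢
  exact h n i hi a (by rwa [hy i hi])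

lemma IsStronglyReg.mem_of_mul_mem {s : Finset ι} (h : IsStronglyReg y s) {x : T}
    (hx : ∀ u, x * u ∈ powIdeal y s 1 → u ∈ powIdeal y s 1) (n : ι → ℕ) :
    ∀ u, x * u ∈ powIdeal y s n → u ∈ powIdeal y s n := by
  induction hN : ∑ j ∈ s, n j using Nat.strong_induction_on generalizing n with
  | _ N ih =>
    intro u hu
    by_cases h0 : ∃ i ∈ s, n i = 0
    · obtain ⟨i, hi, h0⟩ := h0
      have := pow_mem_powIdeal (y := y) n hi
      rw [h0, pow_zero] at this
      rw [(Ideal.eq_top_iff_one _).2 this]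
      trivial
    by_cases h1 : ∀ i ∈ s, n i = 1
    · rw [powIdeal_congr (k := 1) (fun _ _ => rfl) h1] at hu ⊢
      exact hx u hu
    push Not at h0 h1
    obtain ⟨i, hi, h1⟩ := h1
    have hi2 : 2 ≤ n i := by have := h0 i hi; omega
    have key : ∀ k, k < n i → ∑ j ∈ s, Function.update n i k j < N := by
      intro k hk
      rw [← hN]
      refine Finset.sum_lt_sum (fun j hj => ?_) ⟨i, hi, by simpa using hk⟩
      by_cases hji : j = i
      · subst hji; simp [hk.le]
      · simp [hji]
    have er : ∀ k, powIdeal y (s.erase i) (Function.update n i k) = powIdeal y (s.erase i) n :=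
      fun k => powIdeal_congr (fun _ _ => rfl) fun j hj => by
        simp [Finset.ne_of_mem_erase hj]
    have hu' : u ∈ powIdeal y s (Function.update n i (n i - 1)) := by
      refine ih _ (key _ (by omega)) _ rfl u (powIdeal_mono subset_rfl ?_ hu)
      intro j hj
      by_cases hji : j = i
      · subst hji; simp
      · simp [hji]
    obtain ⟨e, he⟩ := (mem_powIdeal_of_mem hi).1 hu'
    obtain ⟨c, hc⟩ := (mem_powIdeal_of_mem hi).1 hu
    rw [er] at he
    simp only [Function.update_self] at he
    have h3 : y i ^ (n i - 1) * (x * e - y i * c) ∈ powIdeal y (s.erase i) n := by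
      have := sub_mem hc (Ideal.mul_mem_left _ x he)
      convert this using 1
      have : y i ^ n i = y i ^ (n i - 1) * y i := by rw [← pow_succ]; congr 1; omega
      rw [this]; ring
    have h4 := h (Function.update n i (n i - 1)) i hi (x * e - y i * c) (by
      rw [er]; simpa using h3)
    rw [er] at h4
    have h5 : x * e ∈ powIdeal y s (Function.update n i 1) :=
      (mem_powIdeal_of_mem hi).2 ⟨c, by rw [er]; simpa using h4⟩
    have h6 := ih _ (key 1 (by omega)) _ rfl e h5
    obtain ⟨b, hb⟩ := (mem_powIdeal_of_mem hi).1 h6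
    rw [er] at hb
    refine (mem_powIdeal_of_mem hi).2 ⟨b, ?_⟩
    have := add_mem he (Ideal.mul_mem_left _ (y i ^ (n i - 1)) hb)
    convert this using 1
    have : y i ^ n i = y i ^ (n i - 1) * y i := by rw [← pow_succ]; congr 1; omega
    rw [this]; simp; ring

lemma mem_of_pow_mul_mem {I : Ideal T} {x : T} (hx : ∀ u, x * u ∈ I → u ∈ I) (k : ℕ) :
    ∀ u, x ^ k * u ∈ I → u ∈ I := by
  induction k with
  | zero => simp
  | succ k ih => exact fun u hu => ih u (hx _ (by rwa [pow_succ', mul_assoc] at hu))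

lemma IsStronglyReg.insert {s : Finset ι} {d : ι} (hd : d ∉ s) (h : IsStronglyReg y s)
    (hx : ∀ u, y d * u ∈ powIdeal y s 1 → u ∈ powIdeal y s 1) :
    IsStronglyReg y (insert d s) := by
  intro n i hi a ha
  have hD := fun u => mem_of_pow_mul_mem (h.mem_of_mul_mem hx n) (n d) u
  by_cases hid : i = d
  · subst hid
    rw [Finset.erase_insert hd] at ha ⊢
    exact hD a ha
  have his : i ∈ s := (Finset.mem_insert.1 hi).resolve_left hid
  rw [Finset.erase_insert_of_ne (Ne.symm hid)] at ha ⊢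
  obtain ⟨b, hb⟩ := mem_powIdeal_insert.1 ha
  have h1 : y d ^ n d * b ∈ powIdeal y s n := by
    have := sub_mem (Ideal.mul_mem_right a _ (pow_mem_powIdeal (y := y) n his))
      (powIdeal_mono (Finset.erase_subset i s) (fun _ _ => le_rfl) hb)
    simpa using this
  obtain ⟨c, hc⟩ := (mem_powIdeal_of_mem his).1 (hD b h1)
  refine mem_powIdeal_insert.2 ⟨c, h n i his _ ?_⟩
  have := add_mem hb (Ideal.mul_mem_left _ (y d ^ n d) hc)
  convert this using 1
  ring

lemma isStronglyReg_of_mul_mem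
    (h : ∀ (s : Finset ι) (i : ι) (u : T), i ∉ s → y i * u ∈ powIdeal y s 1 →
      u ∈ powIdeal y s 1) (s : Finset ι) : IsStronglyReg y s := by
  induction s using Finset.induction_on with
  | empty => intro n i hi; simp at hi
  | insert d s hd ih => exact ih.insert hd fun u => h s d u hd

variable [Fintype ι]

lemma IsStronglyReg.isGood (h : IsStronglyReg y Finset.univ) : IsGood y := by
  intro n i u hu
  have hi := Finset.mem_univ i
  have er : ∀ k, powIdeal y (Finset.univ.erase i) (Function.update n i k) =
      powIdeal y (Finset.univ.erase i) n :=
    fun k => powIdeal_congr (fun _ _ => rfl) fun j hj => by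
      simp [Finset.ne_of_mem_erase hj]
  obtain ⟨c, hc⟩ := (mem_powIdeal_of_mem hi).1 hu
  rw [er] at hc
  refine (mem_powIdeal_of_mem hi).2 ⟨c, ?_⟩
  have := h (Function.update n i 1) i hi (u - y i ^ n i * c) (by
    rw [er]; convert hc using 1; simp; ring)
  rwa [er] at this

lemma IsGood.mem_of_pow_mul (h : IsGood y) (k : ℕ) : ∀ (n : ι → ℕ) (i : ι) (u : T),
    y i ^ k * u ∈ powIdeal y Finset.univ (Function.update n i (n i + k)) →
    u ∈ powIdeal y Finset.univ n := by
  induction k with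
  | zero => intro n i u hu; simpa using hu
  | succ k ih =>
    intro n i u hu
    refine h n i u (ih _ i (y i * u) ?_)
    have e : y i ^ k * (y i * u) = y i ^ (k + 1) * u := by ring
    rw [e]
    convert hu using 2
    simp only [Function.update_self, Function.update_idem, add_assoc, add_comm 1 k]

lemma IsGood.pow (h : IsGood y) (q : ℕ) : IsGood fun i => y i ^ q := by
  have e : ∀ n : ι → ℕ, powIdeal (fun i => y i ^ q) Finset.univ n =
      powIdeal y Finset.univ fun i => q * n i := by
    intro n; simp only [powIdeal, pow_mul]
  intro n i u hu
  rw [e] at hu ⊢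
  refine h.mem_of_pow_mul q _ i u ?_
  convert hu using 2
  ext j
  by_cases hj : j = i
  · subst hj; simp [mul_add]
  · simp [hj]

/-- A good family whose generated ideals are closed is strongly regular. -/
lemma IsGood.mul_mem_of_closed (h : IsGood y) (s : Finset ι)
    (hcl : ∀ u, (∀ k : ℕ, u ∈ powIdeal y s 1 ⊔ powIdeal y Finset.univ (fun _ => k)) →
      u ∈ powIdeal y s 1) {i : ι} (hi : i ∉ s) {u : T} (hu : y i * u ∈ powIdeal y s 1) :
    u ∈ powIdeal y s 1 := by
  refine hcl u fun k => ?_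
  have h1 : u ∈ powIdeal y Finset.univ (fun j => if j ∈ s then 1 else k) := by
    refine h _ i u (powIdeal_mono (Finset.subset_univ _) ?_ hu)
    intro j hj
    have : j ≠ i := fun e => hi (e ▸ hj)
    simp [this, hj]
  refine powIdeal_le.2 (fun j _ => ?_) h1
  split_ifs with hj
  · exact Ideal.mem_sup_left (by simpa using pow_mem_powIdeal (y := y) 1 hj)
  · exact Ideal.mem_sup_right (pow_mem_powIdeal (y := y) (fun _ => k) (Finset.mem_univ j))

end Good

section Good

variable {T ι : Type*} [CommRing T] {y : ι → T}

lemma map_powIdeal {T' : Type*} [CommRing T'] (f : T →+* T') (s : Finset ι) (n : ι → ℕ) :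
    (powIdeal y s n).map f = powIdeal (fun i => f (y i)) s n := by
  simp only [powIdeal, Ideal.map_span, Set.image_image, map_pow]

lemma mem_powIdeal_univ [Fintype ι] {n : ι → ℕ} {u : T} :
    u ∈ powIdeal y Finset.univ n ↔ ∃ c : ι → T, ∑ i, c i * y i ^ n i = u := by
  rw [powIdeal, Finset.coe_univ, Set.image_univ, Ideal.mem_span_range_iff_exists_fun]

lemma mem_powIdeal_pi [Fintype ι] {τ : Type*} {y : ι → τ → T} {n : ι → ℕ} {u : τ → T} :
    u ∈ powIdeal y Finset.univ n ↔ ∀ t, u t ∈ powIdeal (fun i => y i t) Finset.univ n := by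
  simp only [mem_powIdeal_univ]
  constructor
  · rintro ⟨c, rfl⟩ t
    exact ⟨fun i => c i t, by simp⟩
  · intro h
    choose c hc using h
    exact ⟨fun i t => c t i, by ext t; simp [← hc t]⟩

variable [DecidableEq ι] [Fintype ι]

lemma IsGood.pi {τ : Type*} {y : ι → τ → T} (h : ∀ t, IsGood fun i => y i t) : IsGood y := by
  intro n i u hu
  rw [mem_powIdeal_pi] at hu ⊢
  exact fun t => h t n i (u t) (hu t)

lemma IsGood.localization (h : IsGood y) (M : Submonoid T) {T' : Type*} [CommRing T']
    [Algebra T T'] [IsLocalization M T'] : IsGood fun i => algebraMap T T' (y i) := by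
  intro n i u hu
  rw [← map_powIdeal] at hu ⊢
  obtain ⟨⟨a, s⟩, hs⟩ := IsLocalization.surj M u
  have h1 : algebraMap T T' (y i * a) ∈
      (powIdeal y Finset.univ (Function.update n i (n i + 1))).map (algebraMap T T') := by
    rw [map_mul, ← hs, ← mul_assoc]
    exact Ideal.mul_mem_right _ _ hu
  rw [IsLocalization.algebraMap_mem_map_algebraMap_iff M] at h1
  obtain ⟨m, hm, h1⟩ := h1
  have h2 : m * a ∈ powIdeal y Finset.univ n := h n i _ (by convert h1 using 1; ring)
  have h3 := Ideal.mem_map_of_mem (algebraMap T T') h2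
  rw [map_mul, ← hs] at h3
  rwa [Ideal.unit_mul_mem_iff_mem _ (IsLocalization.map_units T' ⟨m, hm⟩),
    Ideal.mul_unit_mem_iff_mem _ (IsLocalization.map_units T' s)] at h3

end Good

lemma isWeaklyRegular_ofFn_iff_s1 {R T : Type*} [CommRing R] [CommRing T] [Algebra R T] {n : ℕ}
    {x : Fin n → R} : RingTheory.Sequence.IsWeaklyRegular T (List.ofFn x) ↔
      ∀ (i : Fin n) (u : T),
        algebraMap R T (x i) * u ∈ powIdeal (fun i => algebraMap R T (x i)) (Finset.Iio i) 1 →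
        u ∈ powIdeal (fun i => algebraMap R T (x i)) (Finset.Iio i) 1 := by
  have key : ∀ k : ℕ, ∀ hk : k < n,
      (Ideal.ofList ((List.ofFn (algebraMap R T ∘ x)).take k) • ⊤ : Ideal T) =
      powIdeal (fun i => algebraMap R T (x i)) (Finset.Iio ⟨k, hk⟩) 1 := by
    intro k hk
    rw [smul_eq_mul, Ideal.mul_top, Ideal.ofList, powIdeal]
    congr 1
    ext r
    simp only [Set.mem_ofPred_eq, List.mem_take_iff_getElem, Set.mem_image]
    constructor
    · rintro ⟨i, hi, rfl⟩
      have hi' : i < k := by omega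
      exact ⟨⟨i, by omega⟩, by simpa using hi', by simp⟩
    · rintro ⟨i, hi, rfl⟩
      have hi' : (i : ℕ) < k := by simpa [Fin.lt_def] using hi
      exact ⟨i, by simp [hi'], by simp⟩
  rw [← RingTheory.Sequence.isWeaklyRegular_map_algebraMap_iff (S := T),
    RingTheory.Sequence.isWeaklyRegular_iff, List.map_ofFn]
  simp only [isSMulRegular_quotient_iff_mem_of_smul_mem]
  constructor
  · intro h i u hu
    have := h i (by simp) u
    rw [key i i.2] at this
    exact this (by simpa using hu)
  · intro h i hi u hu
    have hi' : i < n := by simpa using hi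
    rw [key i hi'] at hu ⊢
    exact h ⟨i, hi'⟩ u (by simpa using hu)

/-- Regular sequences are good families. -/
lemma IsRegSeq.isGood {R T : Type*} [CommRing R] [CommRing T] [Algebra R T] {n : ℕ}
    {x : Fin n → R} (h : IsRegSeq R T x) : IsGood fun i => algebraMap R T (x i) := by
  have h1 := isWeaklyRegular_ofFn_iff_s1.1 h.toIsWeaklyRegular
  have h2 : ∀ k ≤ n, IsStronglyReg (fun i => algebraMap R T (x i))
      (Finset.univ.filter fun i : Fin n => (i : ℕ) < k) := by
    intro k hk
    induction k with
    | zero => intro n i hi; simp at hi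
    | succ k ih =>
      have e : (Finset.univ.filter fun i : Fin n => (i : ℕ) < k) = Finset.Iio ⟨k, hk⟩ := by
        ext i; simp [Fin.lt_def]
      have e' : (Finset.univ.filter fun i : Fin n => (i : ℕ) < k + 1) =
          insert ⟨k, hk⟩ (Finset.univ.filter fun i : Fin n => (i : ℕ) < k) := by
        ext i; simp [Fin.ext_iff]; omega
      rw [e']
      refine (ih (by omega)).insert (by simp) ?_
      rw [e]
      exact h1 ⟨k, hk⟩
  have h3 := h2 n le_rfl
  rw [Finset.filter_true_of_mem fun i _ => i.2] at h3
  exact h3.isGood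

section Asymptotic

open Filter

variable {C : Type*} [CommRing C]

/-- Sequences that eventually lie in the ideal `J`. -/
def eventuallyIdeal (J : Ideal C) : Ideal (ℕ → C) where
  carrier := {w | ∀ᶠ t in atTop, w t ∈ J}
  add_mem' ha hb := by filter_upwards [ha, hb] with t h1 h2 using J.add_mem h1 h2
  zero_mem' := Eventually.of_forall fun _ => J.zero_mem
  smul_mem' c _ hw := by filter_upwards [hw] with t h using J.mul_mem_left (c t) h

lemma mem_eventuallyIdeal {J : Ideal C} {w : ℕ → C} :
    w ∈ eventuallyIdeal J ↔ ∀ᶠ t in atTop, w t ∈ J := Iff.rfl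

/-- Sequences that tend to zero in the `I`-adic topology. -/
def nullIdeal (I : Ideal C) : Ideal (ℕ → C) := ⨅ k : ℕ, eventuallyIdeal (I ^ k)

/-- Sequences in `C` modulo those tending to zero in the `I`-adic topology. -/
abbrev AsymptoticRing (I : Ideal C) : Type _ := (ℕ → C) ⧸ nullIdeal I

variable {I : Ideal C}

lemma eventuallyIdeal_mono {J K : Ideal C} (h : J ≤ K) :
    eventuallyIdeal J ≤ eventuallyIdeal K :=
  fun _ hw => hw.mono fun _ ht => h ht

/-- The diagonal map into the ring of sequences modulo null sequences. -/
def AsymptoticRing.diag (I : Ideal C) : C →+* AsymptoticRing I :=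
  (Ideal.Quotient.mk (nullIdeal I)).comp (Pi.constRingHom ℕ C)

lemma mk_mem_span_iff {ι : Type*} [Fintype ι] {y : ι → C} {u : ℕ → C} :
    Ideal.Quotient.mk (nullIdeal I) u ∈
        Ideal.span (Set.range fun i => AsymptoticRing.diag I (y i)) ↔
      ∀ k : ℕ, ∀ᶠ t in atTop, u t ∈ Ideal.span (Set.range y) ⊔ I ^ k := by
  rw [Ideal.mem_span_range_iff_exists_fun]
  constructor
  · rintro ⟨c, hc⟩ k
    choose c' hc' using fun i => Ideal.Quotient.mk_surjective (c i)
    have h1 : u - ∑ i, c' i * Pi.constRingHom ℕ C (y i) ∈ nullIdeal I := by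
      rw [← Ideal.Quotient.mk_eq_mk_iff_sub_mem, ← hc]
      simp [AsymptoticRing.diag, hc']
    filter_upwards [mem_eventuallyIdeal.1 ((Submodule.mem_iInf _).1 h1 k)] with t ht
    have h2 : ∑ i, c' i t * y i ∈ Ideal.span (Set.range y) :=
      Ideal.mem_span_range_iff_exists_fun.2 ⟨_, rfl⟩
    have := add_mem (Ideal.mem_sup_right (S := Ideal.span (Set.range y)) ht)
      (Ideal.mem_sup_left h2)
    simpa using this
  · intro h
    classical
    let k : ℕ → ℕ := fun t => Nat.findGreatest (fun k => u t ∈ Ideal.span (Set.range y) ⊔ I ^ k) t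
    have hk : ∀ t, u t ∈ Ideal.span (Set.range y) ⊔ I ^ k t := fun t =>
      Nat.findGreatest_spec (P := fun k => u t ∈ Ideal.span (Set.range y) ⊔ I ^ k)
        (Nat.zero_le t) (by simp)
    have h1 : ∀ t, ∃ c : ι → C, u t - ∑ i, c i * y i ∈ I ^ k t := by
      intro t
      obtain ⟨a, ha, b, hb, hab⟩ := Submodule.mem_sup.1 (hk t)
      obtain ⟨c, rfl⟩ := Ideal.mem_span_range_iff_exists_fun.1 ha
      exact ⟨c, by rw [← hab]; simpa using hb⟩
    choose c hc using h1
    refine ⟨fun i => Ideal.Quotient.mk _ fun t => c t i, ?_⟩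
    have h2 : u - ∑ i, (fun t => c t i) * Pi.constRingHom ℕ C (y i) ∈ nullIdeal I := by
      refine (Submodule.mem_iInf _).2 fun l => ?_
      rw [mem_eventuallyIdeal]
      filter_upwards [h l, eventually_ge_atTop l] with t ht htl
      have : l ≤ k t := Nat.le_findGreatest htl ht
      have := Ideal.pow_le_pow_right this (hc t)
      simpa using this
    rw [← Ideal.Quotient.mk_eq_mk_iff_sub_mem] at h2
    rw [h2]
    simp [AsymptoticRing.diag]

lemma eventually_mem_of_mk_mem {J : Ideal C} {k : ℕ} (hk : I ^ k ≤ J) {u : ℕ → C}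
    (hu : Ideal.Quotient.mk (nullIdeal I) u ∈ J.map (AsymptoticRing.diag I)) :
    ∀ᶠ t in atTop, u t ∈ J := by
  rw [AsymptoticRing.diag, ← Ideal.map_map] at hu
  have h1 : (J.map (Pi.constRingHom ℕ C)).map (Ideal.Quotient.mk (nullIdeal I)) ≤
      (eventuallyIdeal J).map (Ideal.Quotient.mk (nullIdeal I)) :=
    Ideal.map_mono (Ideal.map_le_iff_le_comap.2 fun c hc => Eventually.of_forall fun _ => hc)
  have h2 := h1 hu
  rw [Ideal.mem_quotient_iff_mem] at h2
  · exact h2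
  · exact (iInf_le _ k).trans (eventuallyIdeal_mono hk)

/-- Extensions of finitely generated ideals are closed in the ring of sequences modulo null
sequences. -/
lemma AsymptoticRing.mem_span_of_forall {ι : Type*} [Fintype ι] {y : ι → C}
    {u : AsymptoticRing I}
    (h : ∀ k : ℕ, u ∈ Ideal.span (Set.range fun i => AsymptoticRing.diag I (y i)) ⊔
      (I ^ k).map (AsymptoticRing.diag I)) :
    u ∈ Ideal.span (Set.range fun i => AsymptoticRing.diag I (y i)) := by
  obtain ⟨u, rfl⟩ := Ideal.Quotient.mk_surjective u
  refine mk_mem_span_iff.2 fun k => eventually_mem_of_mk_mem (k := k) le_sup_right ?_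
  rw [Ideal.map_sup, Ideal.map_span, ← Set.range_comp]
  exact h k

lemma AsymptoticRing.map_diag_ne_top (h : I ≠ ⊤) : I.map (AsymptoticRing.diag I) ≠ ⊤ := by
  intro h1
  have h2 : Ideal.Quotient.mk (nullIdeal I) 1 ∈ I.map (AsymptoticRing.diag I) := by
    rw [h1]; trivial
  obtain ⟨t, ht⟩ := (eventually_mem_of_mk_mem (k := 1) (by simp) h2).exists
  exact h ((Ideal.eq_top_iff_one _).2 ht)

lemma IsGood.asymptoticRing {ι : Type*} [Fintype ι] [DecidableEq ι] {y : ι → C} (h : IsGood y)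
    (hI : ∀ n : ι → ℕ, ∃ k, I ^ k ≤ powIdeal y Finset.univ n) :
    IsGood fun i => AsymptoticRing.diag I (y i) := by
  intro n i u hu
  obtain ⟨u, rfl⟩ := Ideal.Quotient.mk_surjective u
  obtain ⟨k, hk⟩ := hI (Function.update n i (n i + 1))
  rw [← map_powIdeal] at hu
  have h1 := eventually_mem_of_mk_mem (u := fun t => y i * u t) hk hu
  have h2 : ∀ n, powIdeal (fun i => AsymptoticRing.diag I (y i)) Finset.univ n =
      Ideal.span (Set.range fun i => AsymptoticRing.diag I (y i ^ n i)) := by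
    intro n; simp [powIdeal]
  rw [h2, mk_mem_span_iff]
  intro l
  filter_upwards [h1] with t ht
  have := Ideal.mem_sup_left (T := I ^ l) (h n i _ ht)
  simpa [powIdeal] using this

end Asymptotic

lemma range_update {ι R : Type*} [DecidableEq ι] (x : ι → R) (i : ι) (z : R) :
    Set.range (Function.update x i z) = insert z (x '' {i}ᶜ) := by
  ext r
  simp only [Set.mem_range, Set.mem_insert_iff, Set.mem_image, Set.mem_compl_iff,
    Set.mem_singleton_iff]
  constructor
  · rintro ⟨j, rfl⟩
    by_cases hj : j = i
    · subst hj; simp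
    · exact Or.inr ⟨j, hj, by simp [hj]⟩
  · rintro (rfl | ⟨j, hj, rfl⟩)
    · exact ⟨i, by simp⟩
    · exact ⟨j, by simp [hj]⟩

section SOP

variable {R : Type*} [CommRing R] [IsLocalRing R] {d : ℕ} {x : Fin d → R}

lemma IsSOP.maximalIdeal_pow_le [IsNoetherianRing R] (hx : IsSOP R x) (n : Fin d → ℕ) :
    ∃ k, maximalIdeal R ^ k ≤ powIdeal x Finset.univ n := by
  refine Ideal.exists_pow_le_of_le_radical_of_fg ?_ (IsNoetherian.noetherian _)
  rw [← hx.2.2, Ideal.radical_le_radical_iff, Ideal.span_le]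
  rintro _ ⟨i, rfl⟩
  exact ⟨n i, pow_mem_powIdeal n (Finset.mem_univ i)⟩

lemma IsSOP.powIdeal_const_le (hx : IsSOP R x) (k : ℕ) :
    powIdeal x Finset.univ (fun _ => k) ≤ maximalIdeal R ^ k :=
  powIdeal_le.2 fun i _ => Ideal.pow_mem_pow (hx.2.1 i) k

variable [IsNoetherianRing R]

lemma IsSOP.notMem_minimalPrimes (hx : IsSOP R x) (i : Fin d) :
    maximalIdeal R ∉ (Ideal.span (x '' {i}ᶜ)).minimalPrimes := by
  intro h
  have h1 := Ideal.height_le_card_of_mem_minimalPrimes_span (Set.toFinite _) h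
  have h2 : (x '' {i}ᶜ).ncard ≤ d - 1 := by
    refine (Set.ncard_image_le (Set.toFinite _)).trans ?_
    rw [Set.ncard_compl]
    simp
  have h3 : ((maximalIdeal R).height : WithBot ℕ∞) = d :=
    maximalIdeal_height_eq_ringKrullDim.trans hx.1.symm
  have h4 : (maximalIdeal R).height = d := by exact_mod_cast h3
  rw [h4] at h1
  have h5 : d ≤ (x '' {i}ᶜ).ncard := by exact_mod_cast h1
  have := i.2
  omega

lemma IsSOP.update (hx : IsSOP R x) (i : Fin d) {z : R} (hz : z ∈ maximalIdeal R)
    (hzx : ∀ Q ∈ (Ideal.span (x '' {i}ᶜ)).minimalPrimes, z ∉ Q) :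
    IsSOP R (Function.update x i z) := by
  have hm : ∀ j, Function.update x i z j ∈ maximalIdeal R := by
    intro j
    by_cases hj : j = i
    · subst hj; simpa using hz
    · simpa [hj] using hx.2.1 j
  refine ⟨hx.1, hm, le_antisymm ?_ ?_⟩
  · refine (Ideal.radical_mono (Ideal.span_le.2 ?_)).trans
      (Ideal.IsPrime.radical (I := maximalIdeal R) inferInstance).le
    rintro _ ⟨j, rfl⟩
    exact hm j
  · rw [Ideal.radical_eq_sInf, le_sInf_iff]
    rintro P ⟨hP, hPp⟩
    by_contra hmP
    have hlt : P < maximalIdeal R :=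
      lt_of_le_of_ne (le_maximalIdeal hPp.ne_top) fun e => hmP e.ge
    rw [range_update, Ideal.span_le, Set.insert_subset_iff] at hP
    have hx' : Ideal.span (insert (x i) (x '' {i}ᶜ)) = Ideal.span (Set.range x) := by
      rw [← range_update, Function.update_eq_self]
    have hmin : maximalIdeal R ∈ (Ideal.span (insert (x i) (x '' {i}ᶜ))).minimalPrimes := by
      rw [hx', ← Ideal.radical_minimalPrimes, hx.2.2, Ideal.minimalPrimes_eq_subsingleton_self]
      rfl
    refine hzx P (Ideal.mem_minimalPrimes_span_of_mem_minimalPrimes_span_insert hlt _ _ hmin _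
      hP.2 ?_) hP.1
    exact fun r hr => Ideal.le_radical (Ideal.subset_span (Set.mem_insert_of_mem _ hr))

lemma IsSOP.exists_update {y : Fin d → R} (hx : IsSOP R x) (hy : IsSOP R y) (i : Fin d) :
    ∃ z, IsSOP R (Function.update x i z) ∧ IsSOP R (Function.update y i z) := by
  let S := (Ideal.span (x '' {i}ᶜ)).minimalPrimes ∪ (Ideal.span (y '' {i}ᶜ)).minimalPrimes
  have hS : S.Finite := (Ideal.finite_minimalPrimes_of_isNoetherianRing R _).union
    (Ideal.finite_minimalPrimes_of_isNoetherianRing R _)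
  have hp : ∀ Q ∈ S, Q.IsPrime := fun Q hQ => hQ.elim (fun h => h.1.1) fun h => h.1.1
  have h1 : ¬ ((maximalIdeal R : Set R) ⊆ ⋃ Q ∈ S, (Q : Set R)) := by
    intro h
    obtain ⟨Q, hQ, hle⟩ := (Ideal.subset_union_prime_finite hS (f := fun Q => Q) ⊥ ⊥
      fun Q hQ _ _ => hp Q hQ).1 h
    have e : Q = maximalIdeal R := le_antisymm (le_maximalIdeal (hp Q hQ).ne_top) hle
    subst e
    exact hQ.elim (hx.notMem_minimalPrimes i) (hy.notMem_minimalPrimes i)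
  obtain ⟨z, hz, hz'⟩ := Set.not_subset.1 h1
  simp only [Set.mem_iUnion, not_exists] at hz'
  exact ⟨z, hx.update i hz fun Q hQ => hz' Q (Or.inl hQ),
    hy.update i hz fun Q hQ => hz' Q (Or.inr hQ)⟩

end SOP

section Balanced

variable {R T : Type*} [CommRing R] [IsLocalRing R] [CommRing T] [Algebra R T]

/-- In the `R`-algebra `T`, ideals generated by finitely many elements of `R` are closed in the
topology defined by the maximal ideal of `R`. -/
def HasClosedIdeals (R T : Type*) [CommRing R] [IsLocalRing R] [CommRing T] [Algebra R T] : Prop :=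
  ∀ (d : ℕ) (y : Fin d → R) (s : Finset (Fin d)) (u : T),
    (∀ k : ℕ, u ∈ powIdeal (fun i => algebraMap R T (y i)) s 1 ⊔
      (maximalIdeal R ^ k).map (algebraMap R T)) →
    u ∈ powIdeal (fun i => algebraMap R T (y i)) s 1

variable {d : ℕ} {x : Fin d → R}

lemma IsGood.mul_mem_of_sop (hT : HasClosedIdeals R T) (hx : IsSOP R x)
    (h : IsGood fun i => algebraMap R T (x i)) (s : Finset (Fin d)) (i : Fin d) (u : T)
    (hi : i ∉ s) (hu : algebraMap R T (x i) * u ∈ powIdeal (fun i => algebraMap R T (x i)) s 1) :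
    u ∈ powIdeal (fun i => algebraMap R T (x i)) s 1 := by
  refine h.mul_mem_of_closed s (fun u hu => hT d x s u fun k => ?_) hi hu
  refine (sup_le_sup_left ?_ (powIdeal (fun i => algebraMap R T (x i)) s 1) :) (hu k)
  rw [← map_powIdeal (algebraMap R T)]
  exact Ideal.map_mono (hx.powIdeal_const_le k)

lemma IsGood.update_sop (hT : HasClosedIdeals R T) (hx : IsSOP R x)
    (h : IsGood fun i => algebraMap R T (x i)) (i : Fin d) (z : R)
    (hz : IsSOP R (Function.update x i z)) :
    IsGood fun j => algebraMap R T (Function.update x i z j) := by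
  have hs := isStronglyReg_of_mul_mem (h.mul_mem_of_sop hT hx)
  have hxz : ∀ j ∈ Finset.univ.erase i,
      algebraMap R T (x j) = algebraMap R T (Function.update x i z j) := by
    intro j hj
    rw [Function.update_of_ne (Finset.ne_of_mem_erase hj)]
  have e : ∀ n, powIdeal (fun j => algebraMap R T (Function.update x i z j))
      (Finset.univ.erase i) n = powIdeal (fun j => algebraMap R T (x j)) (Finset.univ.erase i) n :=
    fun n => (powIdeal_congr hxz fun _ _ => rfl).symm
  have h1 := ((hs (Finset.univ.erase i)).congr hxz).insert (d := i) (by simp) ?_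
  · rw [Finset.insert_erase (Finset.mem_univ i)] at h1
    exact h1.isGood
  intro u hu
  rw [e] at hu ⊢
  have hxi : x i ∈ (Ideal.span (Set.range (Function.update x i z))).radical :=
    hz.2.2 ▸ hx.2.1 i
  obtain ⟨N, hN⟩ := hxi
  have hN' : x i ^ N ∈ powIdeal (Function.update x i z) Finset.univ 1 := by
    simpa [powIdeal] using hN
  obtain ⟨c, hc⟩ := (mem_powIdeal_of_mem (Finset.mem_univ i)).1 hN'
  have hc' := Ideal.mem_map_of_mem (algebraMap R T) hc
  rw [map_powIdeal, e] at hc'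
  simp only [Function.update_self, Pi.one_apply, pow_one, map_sub, map_pow, map_mul] at hc' hu
  have h2 := add_mem (Ideal.mul_mem_left _ u hc')
    (Ideal.mul_mem_left _ (algebraMap R T c) hu)
  have e1 : powIdeal (fun i => algebraMap R T (x i)) (Finset.univ.erase i)
      (fun j => if j = i then N else 1) =
      powIdeal (fun i => algebraMap R T (x i)) (Finset.univ.erase i) 1 :=
    powIdeal_congr (fun _ _ => rfl) fun j hj => if_neg (Finset.ne_of_mem_erase hj)
  rw [← e1]
  refine hs Finset.univ (fun j => if j = i then N else 1) i (Finset.mem_univ i) u ?_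
  rw [e1]
  convert h2 using 1
  simp only [if_true]
  ring

variable [IsNoetherianRing R]

lemma IsGood.sop (hT : HasClosedIdeals R T) (hx : IsSOP R x)
    (h : IsGood fun i => algebraMap R T (x i)) {y : Fin d → R} (hy : IsSOP R y) :
    IsGood fun i => algebraMap R T (y i) := by
  classical
  induction hk : (Finset.univ.filter fun i => x i ≠ y i).card using Nat.strong_induction_on
    generalizing x y with
  | _ k ih =>
    by_cases hxy : x = y
    · exact hxy ▸ h
    obtain ⟨i, hi⟩ := Function.ne_iff.1 hxy
    obtain ⟨z, hxz, hyz⟩ := hx.exists_update hy i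
    have h1 := ih _ ?_ hxz (h.update_sop hT hx i z hxz) hyz rfl
    · simpa using h1.update_sop hT hyz i (y i) (by simpa using hy)
    · rw [← hk]
      refine Finset.card_lt_card ⟨fun j hj => ?_, fun hle => ?_⟩
      · by_cases hj' : j = i
        · subst hj'; simp at hj
        · simpa [hj'] using hj
      · simpa using hle (Finset.mem_filter.2 ⟨Finset.mem_univ i, hi⟩)

/-- If ideals are closed in `T` and some system of parameters is good on `T`, then `T` is a
balanced big Cohen-Macaulay algebra. -/
lemma IsGood.isBalancedBigCM (hT : HasClosedIdeals R T) (hx : IsSOP R x)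
    (h : IsGood fun i => algebraMap R T (x i)) (hm : (maximalIdeal R).map (algebraMap R T) ≠ ⊤) :
    IsBalancedBigCM R T := by
  refine ⟨fun n y hy => ?_, hm⟩
  obtain rfl : d = n := by exact_mod_cast hx.1.trans hy.1.symm
  have hg := h.sop hT hx hy
  refine ⟨isWeaklyRegular_ofFn_iff_s1.2 fun i u hu => hg.mul_mem_of_sop hT hy _ i u (by simp) hu, ?_⟩
  intro htop
  refine hm (top_le_iff.1 ?_)
  have h1 : (1 : T) ∈ (Ideal.ofList (List.ofFn y) • ⊤ : Submodule R T) := htop ▸ trivial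
  refine (Submodule.smul_induction_on (p := fun t => t ∈ (maximalIdeal R).map (algebraMap R T))
    h1 ?_ ?_) |> fun h2 => by rw [(Ideal.eq_top_iff_one _).2 h2]
  · intro r hr t _
    rw [Algebra.smul_def]
    refine Ideal.mul_mem_right _ _ (Ideal.mem_map_of_mem _ ?_)
    refine (Ideal.span_le.2 ?_ : Ideal.ofList (List.ofFn y) ≤ maximalIdeal R) hr
    intro r hr
    obtain ⟨i, rfl⟩ := (List.mem_ofFn' _ _).1 hr
    exact hy.2.1 i
  · exact fun _ _ => Ideal.add_mem _

end Balanced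

/-- An algebra on which some system of parameters is good, and on which the maximal ideal does not
expand to the unit ideal, maps to a balanced big Cohen-Macaulay algebra. -/
lemma exists_isBalancedBigCM_of_isGood {R : Type u} [CommRing R] [IsLocalRing R]
    [IsNoetherianRing R] {C : Type v} [CommRing C] [Algebra R C] {d : ℕ} {x : Fin d → R}
    (hx : IsSOP R x) (h : IsGood fun i => algebraMap R C (x i))
    (hm : (maximalIdeal R).map (algebraMap R C) ≠ ⊤) :
    ∃ (T : Type v) (_ : CommRing T) (_ : Algebra R T),
      IsBalancedBigCM R T ∧ Nonempty (C →ₐ[R] T) := by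
  set I := (maximalIdeal R).map (algebraMap R C) with hI
  let φ := AsymptoticRing.diag I
  let _ : Algebra R (AsymptoticRing I) := (φ.comp (algebraMap R C)).toAlgebra
  have halg : ∀ r, algebraMap R (AsymptoticRing I) r = φ (algebraMap R C r) := fun _ => rfl
  have halg' : algebraMap R (AsymptoticRing I) = φ.comp (algebraMap R C) := rfl
  refine ⟨AsymptoticRing I, inferInstance, inferInstance, ?_, ⟨{ φ with commutes' := halg }⟩⟩
  refine IsGood.isBalancedBigCM (x := x) ?_ hx (h.asymptoticRing fun n => ?_) ?_
  · intro n y s u hu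
    have e : powIdeal (fun i => algebraMap R (AsymptoticRing I) (y i)) s 1 =
        Ideal.span (Set.range fun i : s => AsymptoticRing.diag I (algebraMap R C (y i))) := by
      rw [powIdeal, ← Set.image_univ]
      congr 1
      ext r
      simp [halg, φ]
    rw [e] at hu ⊢
    refine AsymptoticRing.mem_span_of_forall fun k => ?_
    convert hu k using 2
    rw [halg', ← Ideal.map_map, Ideal.map_pow (algebraMap R C)]
  · obtain ⟨k, hk⟩ := hx.maximalIdeal_pow_le n
    refine ⟨k, ?_⟩
    rw [hI, ← Ideal.map_pow, ← map_powIdeal (algebraMap R C)]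
    exact Ideal.map_mono hk
  · rw [halg', ← Ideal.map_map]
    exact AsymptoticRing.map_diag_ne_top hm

lemma IsBigCM.exists_isBalancedBigCM {R : Type u} [CommRing R] [IsLocalRing R]
    [IsNoetherianRing R] {C : Type v} [CommRing C] [Algebra R C] (h : IsBigCM R C) :
    ∃ (T : Type v) (_ : CommRing T) (_ : Algebra R T),
      IsBalancedBigCM R T ∧ Nonempty (C →ₐ[R] T) := by
  obtain ⟨⟨d, x, hx, hr⟩, hm⟩ := h
  exact exists_isBalancedBigCM_of_isGood hx hr.isGood hm

theorem subsingleton_h1Cotangent_iff {k A : Type*} [CommRing k] [CommRing A] [Algebra k A] :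
    Subsingleton (Algebra.H1Cotangent k A) ↔ ∀ f : MvPolynomial A k,
      MvPolynomial.aeval (id : A → A) f = 0 →
      (∀ i, MvPolynomial.aeval (id : A → A) (MvPolynomial.pderiv i f) = 0) →
      f ∈ (RingHom.ker (MvPolynomial.aeval (R := k) (id : A → A))) ^ 2 := by
  have hker : (Algebra.Generators.self k A).ker =
      RingHom.ker (MvPolynomial.aeval (R := k) (id : A → A)) :=
    (Algebra.Generators.self k A).ker_eq_ker_aeval_val
  have key (f : (Algebra.Generators.self k A).toExtension.ker) :
      Algebra.Extension.cotangentComplex (Algebra.Generators.self k A).toExtension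
        (.mk f) = 0 ↔
      ∀ i, MvPolynomial.aeval (id : A → A) (MvPolynomial.pderiv i f.1) = 0 := by
    rw [Algebra.Extension.cotangentComplex_mk,
      ← (Algebra.Generators.self k A).cotangentSpaceBasis.repr.map_eq_zero_iff, Finsupp.ext_iff]
    refine forall_congr' fun i => ?_
    exact Eq.congr_left ((Algebra.Generators.self k A).cotangentSpaceBasis_repr_one_tmul f.1 i)
  have key' (f : (Algebra.Generators.self k A).toExtension.ker) :
      (Algebra.Extension.Cotangent.mk f) = 0 ↔
      f.1 ∈ (Algebra.Generators.self k A).toExtension.ker ^ 2 := by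
    rw [← Ideal.toCotangent_eq_zero]
    exact ⟨fun h => congrArg Algebra.Extension.Cotangent.val h,
      fun h => Algebra.Extension.Cotangent.ext h⟩
  refine (Algebra.Extension.subsingleton_h1Cotangent _).trans ?_
  rw [injective_iff_map_eq_zero]
  constructor
  · intro h f hf hd
    have hf' : f ∈ (Algebra.Generators.self k A).ker := hker ▸ hf
    rw [← hker]
    exact (key' ⟨f, hf'⟩).1 (h _ ((key ⟨f, hf'⟩).2 hd))
  · intro h x hx
    obtain ⟨f, rfl⟩ := Algebra.Extension.Cotangent.mk_surjective x
    have hf : f.1 ∈ RingHom.ker (MvPolynomial.aeval (R := k) (id : A → A)) := hker ▸ f.2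
    refine (key' f).2 ?_
    have := h f.1 hf ((key f).1 hx)
    rw [← hker] at this
    exact this

theorem formallySmooth_of_perfectField (k K : Type*) [Field k] [Field K] [Algebra k K]
    [PerfectField k] : Algebra.FormallySmooth k K := by
  refine ⟨inferInstance, subsingleton_h1Cotangent_iff.2 fun f hf hd => ?_⟩
  let L := IntermediateField.adjoin k (f.vars : Set K)
  have : Algebra.EssFiniteType k L :=
    IntermediateField.essFiniteType_iff.2 (IntermediateField.fg_adjoin_finset _)
  have hL := subsingleton_h1Cotangent_iff.1
    (Algebra.FormallySmooth.subsingleton_h1Cotangent (R := k) (A := L))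
  obtain ⟨g, hg⟩ := MvPolynomial.exists_rename_eq_of_vars_subset_range f
    ((↑) : L → K) Subtype.val_injective
    (by rw [Subtype.range_coe]; exact IntermediateField.subset_adjoin k _)
  have hae (q : MvPolynomial L k) : MvPolynomial.aeval (id : K → K)
      (MvPolynomial.rename ((↑) : L → K) q) = (MvPolynomial.aeval (id : L → L) q : L) := by
    rw [MvPolynomial.aeval_rename]
    exact (MvPolynomial.aeval_algebraMap_apply K (id : L → L) q)
  have h2 := hL g (by rw [← hg, hae] at hf; exact_mod_cast hf) (fun i => by
    have := hd i
    rw [← hg, MvPolynomial.pderiv_rename Subtype.val_injective, hae] at this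
    exact_mod_cast this)
  have h3 := Ideal.mem_map_of_mem (MvPolynomial.rename (R := k) ((↑) : L → K)) h2
  rw [Ideal.map_pow, hg] at h3
  refine Ideal.pow_right_mono (Ideal.map_le_iff_le_comap.2 fun q hq => ?_) 2 h3
  rw [RingHom.mem_ker] at hq
  rw [Ideal.mem_comap, RingHom.mem_ker, hae, hq]; rfl

theorem exists_coefficientField (R : Type*) [CommRing R] [IsLocalRing R]
    [IsAdicComplete (maximalIdeal R) R] (p : ℕ) [Fact p.Prime] [CharP R p] :
    ∃ g : ResidueField R →+* R, ∀ a, residue R (g a) = a := by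
  let := ZMod.algebra R p
  have : Algebra.FormallySmooth (ZMod p) (ResidueField R) :=
    formallySmooth_of_perfectField (ZMod p) (ResidueField R)
  obtain ⟨g, hg⟩ := Algebra.FormallySmooth.exists_mkₐ_comp_eq_of_isAdicComplete
    (R := ZMod p) (S := R) (A := ResidueField R) (I := maximalIdeal R)
    (AlgHom.id (ZMod p) (ResidueField R))
  exact ⟨g, fun a => DFunLike.congr_fun hg a⟩

theorem exists_span_range_pow_le_powIdeal {ι T : Type*} [CommRing T] [Fintype ι] (y : ι → T)
    (n : ι → ℕ) : ∃ k, Ideal.span (Set.range y) ^ k ≤ powIdeal y Finset.univ n := by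
  refine Ideal.exists_pow_le_of_le_radical_of_fg ?_ (Submodule.fg_span (Set.finite_range y))
  rw [Ideal.span_le]
  rintro _ ⟨i, rfl⟩
  exact ⟨n i, pow_mem_powIdeal _ (Finset.mem_univ i)⟩

theorem powIdeal_const_le_span_range_pow {ι T : Type*} [CommRing T] [Fintype ι] (y : ι → T)
    (k : ℕ) : powIdeal y Finset.univ (fun _ => k) ≤ Ideal.span (Set.range y) ^ k := by
  refine powIdeal_le.2 fun i _ => ?_
  exact Ideal.pow_mem_pow (Ideal.subset_span (Set.mem_range_self i)) _

namespace MvPowerSeries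

variable {σ K : Type*} [CommRing K]

theorem coeff_eq_zero_of_mem_powIdeal {s : Finset σ} {n : σ → ℕ} {a : MvPowerSeries σ K}
    (ha : a ∈ powIdeal (fun i => (X i : MvPowerSeries σ K)) s n) {m : σ →₀ ℕ}
    (hm : ∀ i ∈ s, m i < n i) : coeff m a = 0 := by
  refine Submodule.span_induction ?_ ?_ ?_ ?_ ha
    (p := fun a _ => ∀ m : σ →₀ ℕ, (∀ i ∈ s, m i < n i) → coeff m a = 0) m hm
  · rintro _ ⟨i, hi, rfl⟩ m hm
    exact X_pow_dvd_iff.1 dvd_rfl m (hm i hi)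
  · simp
  · intro a b _ _ ha hb m hm
    rw [map_add, ha m hm, hb m hm, add_zero]
  · intro c a _ ha m hm
    classical
    rw [smul_eq_mul, coeff_mul]
    refine Finset.sum_eq_zero fun q hq => ?_
    rw [ha q.2 fun i hi => (le_of_le_of_eq (Nat.le_add_left _ _)
      (DFunLike.congr_fun (Finset.HasAntidiagonal.mem_antidiagonal.1 hq) i)).trans_lt (hm i hi),
      mul_zero]

theorem mem_powIdeal_of_coeff_eq_zero (s : Finset σ) {n : σ → ℕ} {a : MvPowerSeries σ K}
    (h : ∀ m : σ →₀ ℕ, (∀ i ∈ s, m i < n i) → coeff m a = 0) :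
    a ∈ powIdeal (fun i => (X i : MvPowerSeries σ K)) s n := by
  classical
  induction s using Finset.induction_on generalizing a with
  | empty =>
    have : a = 0 := by ext m; simpa using h m
    rw [this]; exact zero_mem _
  | insert i s _ ih =>
    let b : MvPowerSeries σ K := fun m => if m i < n i then coeff m a else 0
    have hb (m) : coeff m b = if m i < n i then coeff m a else 0 := rfl
    rw [← sub_add_cancel a b]
    refine add_mem ?_ ?_
    · have : X i ^ n i ∣ a - b := X_pow_dvd_iff.2 fun m hm => by
        rw [map_sub, hb, if_pos hm, sub_self]
      exact Ideal.mem_of_dvd _ this (pow_mem_powIdeal _ (Finset.mem_insert_self i s))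
    · refine powIdeal_mono (Finset.subset_insert i s) (fun _ _ => le_rfl) (ih fun m hm => ?_)
      rw [hb]
      split_ifs with hi
      · refine h m fun j hj => ?_
        rcases Finset.mem_insert.1 hj with rfl | hj
        exacts [hi, hm j hj]
      · rfl

variable [Fintype σ]

theorem ker_constantCoeff_eq_span : RingHom.ker (constantCoeff (σ := σ) (R := K)) =
    Ideal.span (Set.range fun i => (X i : MvPowerSeries σ K)) := by
  refine le_antisymm (fun a ha => ?_) (Ideal.span_le.2 ?_)
  · have : a ∈ powIdeal (fun i => (X i : MvPowerSeries σ K)) Finset.univ (fun _ => 1) := by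
      refine mem_powIdeal_of_coeff_eq_zero _ fun m hm => ?_
      have : m = 0 := by ext i; simpa using hm i
      rw [this, coeff_zero_eq_constantCoeff_apply]; exact ha
    simpa using powIdeal_const_le_span_range_pow _ 1 this
  · rintro _ ⟨i, rfl⟩
    simp [RingHom.mem_ker]

theorem isMaximal_span_range_X {K : Type*} [Field K] :
    (Ideal.span (Set.range fun i => (X i : MvPowerSeries σ K))).IsMaximal := by
  rw [← ker_constantCoeff_eq_span]
  exact RingHom.ker_isMaximal_of_surjective _ fun a => ⟨C a, constantCoeff_C a⟩

theorem isAdicComplete_span_range_X :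
    IsAdicComplete (Ideal.span (Set.range fun i => (X i : MvPowerSeries σ K)))
      (MvPowerSeries σ K) := by
  choose N hN using fun k : ℕ => exists_span_range_pow_le_powIdeal
    (fun i => (X i : MvPowerSeries σ K)) (fun _ => k)
  have hlt (m : σ →₀ ℕ) (i : σ) : m i < m.degree + 1 := Nat.lt_succ_of_le (Finsupp.le_degree i m)
  refine { haus' := fun a ha => ?_, prec' := fun f hf => ?_ }
  · ext m
    have := ha (N (m.degree + 1))
    rw [SModEq.zero, smul_eq_mul, Ideal.mul_top] at this
    exact coeff_eq_zero_of_mem_powIdeal (hN _ this) fun i _ => hlt m i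
  · simp only [smul_eq_mul, Ideal.mul_top, SModEq.sub_mem] at hf ⊢
    have hf' {k l l' : ℕ} (hl : N k ≤ l) (hl' : N k ≤ l') : f l - f l' ∈
        powIdeal (fun i => (X i : MvPowerSeries σ K)) Finset.univ (fun _ => k) := by
      have := sub_mem (hf hl') (hf hl)
      rw [sub_sub_sub_cancel_left] at this
      exact hN k this
    let L : MvPowerSeries σ K := fun m => coeff m (f (N (m.degree + 1)))
    have hL (m) : coeff m L = coeff m (f (N (m.degree + 1))) := rfl
    refine ⟨L, fun k => ?_⟩
    rw [← sub_add_sub_cancel _ (f (max k (N k)))]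
    refine add_mem (hf (le_max_left _ _)) (powIdeal_const_le_span_range_pow _ k
      (mem_powIdeal_of_coeff_eq_zero _ fun m hm => ?_))
    rw [map_sub, hL]
    set q := max (max k (N k)) (N (m.degree + 1))
    have h1 := coeff_eq_zero_of_mem_powIdeal
      (hf' (k := k) (l := max k (N k)) (l' := q) (le_max_right _ _)
        ((le_max_right _ _).trans (le_max_left _ _))) hm
    have h2 := coeff_eq_zero_of_mem_powIdeal
      (hf' (k := m.degree + 1) (l := q) (l' := N (m.degree + 1)) (le_max_right _ _) le_rfl)
      fun i _ => hlt m i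
    rw [map_sub] at h1 h2
    linear_combination h1 + h2

end MvPowerSeries

theorem isPrecomplete_fun {A ι : Type*} [CommRing A] [Finite ι] (I : Ideal A)
    [IsPrecomplete I A] : IsPrecomplete I (ι → A) := by
  classical
  cases nonempty_fintype ι
  have hmem (k : ℕ) (v : ι → A) : v ∈ (I ^ k • ⊤ : Submodule A (ι → A)) ↔ ∀ i, v i ∈ I ^ k := by
    constructor
    · intro h i
      have := Submodule.mem_map_of_mem (f := LinearMap.proj (R := A) (φ := fun _ : ι => A) i) h
      rw [Submodule.map_smul''] at this
      simpa using Submodule.smul_mono le_rfl le_top this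
    · intro h
      rw [pi_eq_sum_univ' v]
      exact sum_mem fun i _ => Submodule.smul_mem_smul (h i) trivial
  refine ⟨fun f hf => ?_⟩
  simp only [SModEq.sub_mem, hmem] at hf ⊢
  have h (i : ι) := IsPrecomplete.prec (I := I) (M := A) inferInstance (f := fun n => f n i)
    (fun hmn => by
      rw [SModEq.sub_mem, smul_eq_mul, Ideal.mul_top]
      exact hf hmn i)
  choose L hL using h
  refine ⟨L, fun n i => ?_⟩
  have := hL i n
  rwa [SModEq.sub_mem, smul_eq_mul, Ideal.mul_top] at this

theorem exists_finite_span_sup_pow {A R : Type*} [CommRing A] [CommRing R] [Algebra A R]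
    {m : Ideal R} (hm : m.FG) (hA : ∀ r : R, ∃ a : A, r - algebraMap A R a ∈ m) (k : ℕ) :
    ∃ s : Set R, s.Finite ∧ ∀ r, ∃ t ∈ Submodule.span A s, r - t ∈ m ^ k := by
  obtain ⟨g, rfl⟩ := hm
  induction k with
  | zero => exact ⟨∅, Set.finite_empty, fun r => ⟨0, zero_mem _, by simp⟩⟩
  | succ k ih =>
    obtain ⟨s, hs, h⟩ := ih
    refine ⟨insert 1 (Set.image2 (· * ·) g s), (g.finite_toSet.image2 _ hs).insert 1, fun r => ?_⟩
    obtain ⟨a, ha⟩ := hA r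
    have key : ∀ z ∈ Ideal.span (g : Set R), ∀ r : R, ∃ t ∈ Submodule.span A
        (insert 1 (Set.image2 (· * ·) g s)), r * z - t ∈ Ideal.span (g : Set R) ^ (k + 1) := by
      intro z hz
      induction hz using Submodule.span_induction with
      | mem z hz =>
        intro r
        obtain ⟨t, ht, htr⟩ := h r
        refine ⟨z * t, ?_, ?_⟩
        · refine Submodule.span_mono (Set.subset_insert _ _) ?_
          have : z * t ∈ Submodule.span A (g : Set R) * Submodule.span A s :=
            Submodule.mul_mem_mul (Submodule.subset_span hz) ht
          rwa [Submodule.span_mul_span] at this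
        · rw [pow_succ', mul_comm r, ← mul_sub]
          exact Ideal.mul_mem_mul (Ideal.subset_span hz) htr
      | zero => exact fun r => ⟨0, zero_mem _, by simp⟩
      | add z w _ _ hz hw =>
        intro r
        obtain ⟨t, ht, htr⟩ := hz r
        obtain ⟨u, hu, hur⟩ := hw r
        refine ⟨t + u, add_mem ht hu, ?_⟩
        rw [mul_add, add_sub_add_comm]
        exact add_mem htr hur
      | smul c z _ hz =>
        intro r
        obtain ⟨t, ht, htr⟩ := hz (r * c)
        exact ⟨t, ht, by rwa [smul_eq_mul, ← mul_assoc]⟩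
    obtain ⟨t, ht, htr⟩ := key _ ha 1
    refine ⟨algebraMap A R a + t, add_mem ?_ ht, by rwa [← sub_sub, ← one_mul (r - _)]⟩
    rw [Algebra.algebraMap_eq_smul_one]
    exact Submodule.smul_mem _ _ (Submodule.subset_span (Set.mem_insert _ _))

theorem finite_of_isAdicComplete {A R : Type*} [CommRing A] [CommRing R] [Algebra A R]
    (I : Ideal A) [IsPrecomplete I A] {m : Ideal R} [IsHausdorff m R] (hm : m.FG)
    (hA : ∀ r : R, ∃ a : A, r - algebraMap A R a ∈ m)
    (hI : I.map (algebraMap A R) ≤ m) {k : ℕ} (hk : m ^ k ≤ I.map (algebraMap A R)) :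
    Module.Finite A R := by
  obtain ⟨s, hs, h⟩ := exists_finite_span_sup_pow hm hA k
  have := hs.to_subtype
  have := isPrecomplete_fun (ι := s) I
  have : IsHausdorff I R := by
    refine ⟨fun r hr => IsHausdorff.haus (I := m) inferInstance r fun n => ?_⟩
    have := hr n
    rw [SModEq.zero] at this ⊢
    rw [smul_eq_mul, Ideal.mul_top]
    rw [Ideal.smul_top_eq_map, Submodule.restrictScalars_mem, Ideal.map_pow] at this
    exact Ideal.pow_right_mono hI n this
  cases nonempty_fintype s
  refine Module.Finite.of_surjective (Fintype.linearCombination A ((↑) : s → R))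
    (surjective_of_mkQ_comp_surjective (I := I) fun q => ?_)
  obtain ⟨r, rfl⟩ := Submodule.mkQ_surjective _ q
  obtain ⟨t, ht, htr⟩ := h r
  have ht' : t ∈ Submodule.span A (Set.range ((↑) : s → R)) := by rwa [Subtype.range_coe]
  rw [← Fintype.range_linearCombination] at ht'
  obtain ⟨c, rfl⟩ := ht'
  refine ⟨c, ?_⟩
  rw [LinearMap.comp_apply, ← sub_eq_zero, ← map_sub, Submodule.mkQ_apply,
    Submodule.Quotient.mk_eq_zero, Ideal.smul_top_eq_map, Submodule.restrictScalars_mem,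
    ← neg_mem_iff, neg_sub]
  exact hk htr

theorem exists_ringHom_mvPowerSeries {σ K R : Type*} [Finite σ] [CommRing K] [CommRing R]
    (m : Ideal R) [IsAdicComplete m R] (g : K →+* R) (x : σ → R) (hx : ∀ i, x i ∈ m) :
    ∃ φ : MvPowerSeries σ K →+* R,
      (∀ i, φ (MvPowerSeries.X i) = x i) ∧ ∀ c, φ (MvPowerSeries.C c) = g c := by
  let : WithIdeal R := ⟨m⟩
  let : UniformSpace K := ⊥
  have : DiscreteTopology K := ⟨rfl⟩
  have : IsUniformAddGroup K := inferInstance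
  have hc := IsAdic.isAdicComplete_iff (R := R) (I := m) rfl |>.1 inferInstance
  have := hc.1
  have := hc.2
  have hcont : Continuous g := continuous_of_discreteTopology
  have hev : MvPowerSeries.HasEval x := by
    refine ⟨fun i => ?_, by simp [Filter.cofinite_eq_bot]⟩
    refine (IsAdic.hasBasis_nhds_zero (I := m) rfl).tendsto_right_iff.2 fun n _ => ?_
    filter_upwards [Filter.eventually_ge_atTop n] with k hk
    exact Ideal.pow_le_pow_right hk (Ideal.pow_mem_pow (hx i) k)
  refine ⟨MvPowerSeries.eval₂Hom hcont hev, fun i => ?_, fun c => ?_⟩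
  · rw [MvPowerSeries.coe_eval₂Hom, MvPowerSeries.eval₂_X]
  · rw [MvPowerSeries.coe_eval₂Hom, MvPowerSeries.eval₂_C]

theorem IsSOP.exists_finite_regular {R : Type u} [CommRing R] [IsLocalRing R] [IsNoetherianRing R]
    [IsAdicComplete (maximalIdeal R) R] (p : ℕ) [Fact p.Prime] [CharP R p] {d : ℕ}
    {x : Fin d → R} (hx : IsSOP R x) :
    ∃ (A : Type u) (_ : CommRing A) (_ : IsDomain A) (_ : Algebra A R) (y : Fin d → A),
      (Ideal.span (Set.range y)).IsMaximal ∧ IsAdicComplete (Ideal.span (Set.range y)) A ∧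
      Module.Finite A R ∧ ∀ i, algebraMap A R (y i) = x i := by
  obtain ⟨g, hg⟩ := exists_coefficientField R p
  obtain ⟨φ, hφX, hφC⟩ := exists_ringHom_mvPowerSeries (maximalIdeal R) g x hx.2.1
  let := φ.toAlgebra
  have hmap : (Ideal.span (Set.range fun i =>
      (MvPowerSeries.X i : MvPowerSeries (Fin d) (ResidueField R)))).map
        (algebraMap (MvPowerSeries (Fin d) (ResidueField R)) R) = Ideal.span (Set.range x) := by
    rw [Ideal.map_span, ← Set.range_comp]
    congr 2
    exact funext hφX
  have hcomp := MvPowerSeries.isAdicComplete_span_range_X (σ := Fin d) (K := ResidueField R)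
  obtain ⟨k, hk⟩ := hx.maximalIdeal_pow_le 1
  refine ⟨MvPowerSeries (Fin d) (ResidueField R), inferInstance, NoZeroDivisors.to_isDomain _,
    inferInstance, fun i => MvPowerSeries.X i, MvPowerSeries.isMaximal_span_range_X, hcomp, ?_, hφX⟩
  refine finite_of_isAdicComplete (Ideal.span (Set.range fun i =>
    (MvPowerSeries.X i : MvPowerSeries (Fin d) (ResidueField R)))) (m := maximalIdeal R) (k := k)
    (IsNoetherian.noetherian _) (fun r => ⟨MvPowerSeries.C (residue R r), ?_⟩) ?_ ?_
  · rw [← residue_eq_zero_iff, map_sub]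
    exact sub_eq_zero.2 ((congrArg (residue R) (hφC _)).trans (hg _)).symm
  · rw [hmap, ← hx.2.2]
    exact Ideal.le_radical
  · rw [hmap]
    exact hk.trans ((powIdeal_const_le_span_range_pow x 1).trans (pow_one _).le)

section DualBasis

variable {A ι B τ : Type*} [CommRing A] [Fintype ι] [DecidableEq ι] {y : ι → A}
  [CommRing B] [Algebra A B] {e : τ → B}

theorem pow_mul_mem_powIdeal_update (n : ι → ℕ) (i : ι) (k : ℕ) {u : A}
    (hu : u ∈ powIdeal y Finset.univ n) :
    y i ^ k * u ∈ powIdeal y Finset.univ (Function.update n i (n i + k)) := by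
  have : powIdeal y Finset.univ n ≤ Submodule.comap (LinearMap.mulLeft A (y i ^ k))
      (powIdeal y Finset.univ (Function.update n i (n i + k))) := by
    refine powIdeal_le.2 fun j _ => ?_
    rw [Submodule.mem_comap, LinearMap.mulLeft_apply]
    by_cases hj : j = i
    · subst hj
      rw [← pow_add, add_comm k]
      simpa only [Function.update_self] using
        pow_mem_powIdeal (y := y) (Function.update n j (n j + k)) (Finset.mem_univ j)
    · refine Ideal.mul_mem_left _ _ ?_
      simpa [hj] using pow_mem_powIdeal (y := y) (Function.update n i (n i + k)) (Finset.mem_univ j)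
  exact this hu

omit [DecidableEq ι] in
theorem powIdeal_smul_top (n : ι → ℕ) {u : B} :
    u ∈ powIdeal y Finset.univ n • (⊤ : Submodule A B) ↔
      u ∈ powIdeal (fun i => algebraMap A B (y i)) Finset.univ n := by
  rw [Ideal.smul_top_eq_map, map_powIdeal, Submodule.restrictScalars_mem]

theorem span_range_sup_pow_smul_top {I : Ideal A}
    (he : Submodule.span A (Set.range e) ⊔ I • ⊤ = ⊤) (k : ℕ) :
    Submodule.span A (Set.range e) ⊔ I ^ k • ⊤ = ⊤ := by
  induction k with
  | zero => rw [pow_zero, Ideal.one_eq_top, Submodule.top_smul, sup_top_eq]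
  | succ k ih =>
    refine top_le_iff.1 (ih.ge.trans (sup_le le_sup_left ?_))
    conv_lhs => rw [← he, Submodule.smul_sup, smul_smul, ← pow_succ]
    exact sup_le_sup_right Submodule.smul_le_right _

theorem coeff_mem_powIdeal_of_sum_mem (hy : IsGood fun i => algebraMap A B (y i))
    (he : ∀ (s : Finset τ) (c : τ → A),
      ∑ t ∈ s, c t • e t ∈ Ideal.span (Set.range y) • (⊤ : Submodule A B) →
        ∀ t ∈ s, c t ∈ Ideal.span (Set.range y))
    (n : ι → ℕ) (s : Finset τ) (c : τ → A)
    (h : ∑ t ∈ s, c t • e t ∈ powIdeal y Finset.univ n • (⊤ : Submodule A B)) :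
    ∀ t ∈ s, c t ∈ powIdeal y Finset.univ n := by
  induction hN : ∑ i, n i using Nat.strong_induction_on generalizing n c with
  | _ N ih =>
    by_cases h2 : ∃ i, 2 ≤ n i
    · obtain ⟨i, hi⟩ := h2
      have hlt (m : ℕ) (hm : m < n i) : ∑ j, Function.update n i m j < N := by
        rw [← hN]
        refine Finset.sum_lt_sum (fun j _ => ?_) ⟨i, Finset.mem_univ i, by simpa⟩
        by_cases hj : j = i
        · subst hj; simpa using hm.le
        · simp [hj]
      obtain ⟨k, hk⟩ : ∃ k, n i = 1 + k := ⟨n i - 1, by omega⟩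
      have hle : powIdeal y Finset.univ n ≤ powIdeal y Finset.univ (Function.update n i k) := by
        refine powIdeal_mono subset_rfl fun j _ => ?_
        by_cases hj : j = i
        · subst hj; simp [hk]
        · simp [hj]
      have h1 := ih _ (hlt k (by omega)) (Function.update n i k) c
        (Submodule.smul_mono_left hle h) rfl
      have : ∀ t ∈ s, ∃ a, c t - y i ^ k * a ∈ powIdeal y Finset.univ n := by
        intro t ht
        obtain ⟨a, ha⟩ := (mem_powIdeal_of_mem (Finset.mem_univ i)).1 (h1 t ht)
        refine ⟨a, ?_⟩
        rw [Function.update_self] at ha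
        refine powIdeal_mono (Finset.subset_univ _) (fun j hj => ?_) ha
        rw [Function.update_of_ne (Finset.ne_of_mem_erase hj)]
      choose! a ha using this
      have hn : n = Function.update (Function.update n i 1) i (Function.update n i 1 i + k) := by
        rw [Function.update_self, Function.update_idem, ← hk, Function.update_eq_self]
      have h3 : ∑ t ∈ s, a t • e t ∈
          powIdeal y Finset.univ (Function.update n i 1) • (⊤ : Submodule A B) := by
        rw [powIdeal_smul_top]
        refine hy.mem_of_pow_mul k _ i _ ?_
        rw [← hn, ← powIdeal_smul_top]
        have : algebraMap A B (y i) ^ k * ∑ t ∈ s, a t • e t =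
            ∑ t ∈ s, c t • e t - ∑ t ∈ s, (c t - y i ^ k * a t) • e t := by
          rw [← map_pow, ← Algebra.smul_def, Finset.smul_sum, ← Finset.sum_sub_distrib]
          refine Finset.sum_congr rfl fun t _ => ?_
          rw [sub_smul, sub_sub_cancel, smul_smul]
        rw [this]
        exact sub_mem h (sum_mem fun t ht => Submodule.smul_mem_smul (ha t ht) trivial)
      intro t ht
      have h4 := ih _ (hlt 1 (by omega)) (Function.update n i 1) a h3 rfl t ht
      have h5 := pow_mul_mem_powIdeal_update _ i k h4
      rw [← hn] at h5
      simpa using add_mem (ha t ht) h5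
    · push Not at h2
      by_cases h0 : ∃ i, n i = 0
      · obtain ⟨i, hi⟩ := h0
        have : powIdeal y Finset.univ n = ⊤ := by
          rw [Ideal.eq_top_iff_one]
          simpa [hi] using pow_mem_powIdeal (y := y) n (Finset.mem_univ i)
        rw [this]
        exact fun _ _ => trivial
      · push Not at h0
        obtain rfl : n = fun _ => 1 := funext fun i => by have := h0 i; have := h2 i; omega
        have : powIdeal y Finset.univ (fun _ => 1) = Ideal.span (Set.range y) := by
          simp [powIdeal]
        rw [this] at h ⊢
        exact he s c h

theorem exists_coeff_linearMap [IsAdicComplete (Ideal.span (Set.range y)) A]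
    (hy : IsGood fun i => algebraMap A B (y i))
    (he : ∀ (s : Finset τ) (c : τ → A),
      ∑ t ∈ s, c t • e t ∈ Ideal.span (Set.range y) • (⊤ : Submodule A B) →
        ∀ t ∈ s, c t ∈ Ideal.span (Set.range y))
    (hspan : Submodule.span A (Set.range e) ⊔ Ideal.span (Set.range y) • ⊤ = ⊤) (t : τ) :
    ∃ α : B →ₗ[A] A, α (e t) = 1 ∧ ∀ t', t' ≠ t → α (e t') = 0 := by
  set J : ℕ → Ideal A := fun n => powIdeal y Finset.univ fun _ => n with hJ
  have hJmono {m n : ℕ} (h : m ≤ n) : J n ≤ J m := powIdeal_mono subset_rfl fun _ _ => h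
  have hinj (n : ℕ) (c : τ →₀ A)
      (h : Finsupp.linearCombination A e c ∈ J n • (⊤ : Submodule A B)) : c t ∈ J n := by
    by_cases ht : t ∈ c.support
    · exact coeff_mem_powIdeal_of_sum_mem hy he _ _ c h t ht
    · rw [Finsupp.notMem_support_iff.1 ht]; exact zero_mem _
  have hsurj (n : ℕ) (b : B) : ∃ c : τ →₀ A,
      b - Finsupp.linearCombination A e c ∈ J n • (⊤ : Submodule A B) := by
    obtain ⟨k, hk⟩ := exists_span_range_pow_le_powIdeal y fun _ => n
    have hb : b ∈ Submodule.span A (Set.range e) ⊔ Ideal.span (Set.range y) ^ k • ⊤ := by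
      rw [span_range_sup_pow_smul_top hspan]; trivial
    obtain ⟨u, hu, v, hv, rfl⟩ := Submodule.mem_sup.1 hb
    obtain ⟨c, rfl⟩ := (Finsupp.mem_span_range_iff_exists_finsupp).1 hu
    refine ⟨c, ?_⟩
    rw [Finsupp.linearCombination_apply, add_sub_cancel_left]
    exact Submodule.smul_mono_left hk hv
  let Rel (b : B) (a : A) : Prop := ∀ n, ∃ c : τ →₀ A,
    b - Finsupp.linearCombination A e c ∈ J n • (⊤ : Submodule A B) ∧ c t - a ∈ J n
  have hunique {b : B} {a a' : A} (h : Rel b a) (h' : Rel b a') : a = a' := by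
    rw [← sub_eq_zero]
    refine IsHausdorff.haus (I := Ideal.span (Set.range y)) inferInstance _ fun n => ?_
    rw [SModEq.zero, smul_eq_mul, Ideal.mul_top]
    refine powIdeal_const_le_span_range_pow y n ?_
    obtain ⟨c, hc, hca⟩ := h n
    obtain ⟨c', hc', hca'⟩ := h' n
    have := hinj n (c - c') (by
      rw [map_sub]
      have := sub_mem hc' hc
      rwa [sub_sub_sub_cancel_left] at this)
    rw [Finsupp.sub_apply] at this
    have h2 := add_mem this (sub_mem hca' hca)
    convert h2 using 1
    ring
  have hexists (b : B) : ∃ a, Rel b a := by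
    choose c hc using fun n => hsurj n b
    have hcc {m n : ℕ} (h : m ≤ n) : c m t - c n t ∈ J m := by
      refine hinj m (c m - c n) ?_
      have := sub_mem (Submodule.smul_mono_left (hJmono h) (hc n)) (hc m)
      rwa [sub_sub_sub_cancel_left, ← map_sub] at this
    obtain ⟨a, ha⟩ := IsPrecomplete.prec (I := Ideal.span (Set.range y)) (M := A) inferInstance
      (f := fun n => c n t) (fun {m n} h => by
        rw [SModEq.sub_mem, smul_eq_mul, Ideal.mul_top]
        exact powIdeal_const_le_span_range_pow y m (hcc h))
    refine ⟨a, fun n => ?_⟩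
    obtain ⟨k, hk⟩ := exists_span_range_pow_le_powIdeal y fun _ => n
    refine ⟨c (max n k), Submodule.smul_mono_left (hJmono (le_max_left _ _)) (hc _), hk ?_⟩
    have := ha (max n k)
    rw [SModEq.sub_mem, smul_eq_mul, Ideal.mul_top] at this
    exact Ideal.pow_le_pow_right (le_max_right _ _) this
  choose α hα using hexists
  have hbasis (t' : τ) : Rel (e t') (Finsupp.single t' 1 t) := fun n =>
    ⟨Finsupp.single t' 1, by simp, by simp⟩
  refine ⟨{ toFun := α, map_add' := fun b b' => ?_, map_smul' := fun r b => ?_ }, ?_, ?_⟩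
  · refine hunique (hα _) fun n => ?_
    obtain ⟨c, hc, hca⟩ := hα b n
    obtain ⟨c', hc', hca'⟩ := hα b' n
    refine ⟨c + c', ?_, ?_⟩
    · rw [map_add, add_sub_add_comm]; exact add_mem hc hc'
    · rw [Finsupp.add_apply, add_sub_add_comm]; exact add_mem hca hca'
  · refine hunique (hα _) fun n => ?_
    obtain ⟨c, hc, hca⟩ := hα b n
    refine ⟨r • c, ?_, ?_⟩
    · rw [map_smul, ← smul_sub]; exact Submodule.smul_mem _ r hc
    · rw [Finsupp.smul_apply, RingHom.id_apply, smul_eq_mul, smul_eq_mul, ← mul_sub]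
      exact Ideal.mul_mem_left _ r hca
  · simpa using hunique (hα (e t)) (hbasis t)
  · intro t' ht'
    simpa [ht'] using hunique (hα (e t')) (hbasis t')

end DualBasis

section ResidueBasis

variable {A : Type*} {B : Type v} [CommRing A] [CommRing B] [Algebra A B]

theorem exists_residue_basis (I : Ideal A) [I.IsMaximal] :
    ∃ (τ : Type v) (e : τ → B),
      (∀ (s : Finset τ) (c : τ → A), ∑ t ∈ s, c t • e t ∈ I • (⊤ : Submodule A B) →
        ∀ t ∈ s, c t ∈ I) ∧
      Submodule.span A (Set.range e) ⊔ I • ⊤ = ⊤ ∧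
      ((1 : B) ∉ I • (⊤ : Submodule A B) → ∃ t, e t = 1) := by
  classical
  let : Field (A ⧸ I) := Ideal.Quotient.field I
  set V := B ⧸ (I • ⊤ : Submodule A B) with hV
  let π : B →ₗ[A] V := Submodule.mkQ _
  let s₀ : Set V := {v | v = π 1 ∧ v ≠ 0}
  have hs₀ : LinearIndepOn (A ⧸ I) id s₀ := by
    by_cases h : π 1 = 0
    · have : s₀ = ∅ := Set.eq_empty_of_forall_notMem fun v hv => hv.2 (hv.1.trans h)
      rw [this]
      exact linearIndepOn_empty _ _
    · have : s₀ = {π 1} := Set.ext fun v => ⟨fun hv => hv.1, fun hv => ⟨hv, hv ▸ h⟩⟩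
      rw [this]
      exact LinearIndepOn.singleton h
  let b := Module.Basis.extend hs₀
  have hb (t) : b t = t := Module.Basis.extend_apply_self hs₀ t
  have hlift (t : hs₀.extend (Set.subset_univ _)) : ∃ u : B, π u = t ∧ ((t : V) = π 1 → u = 1) := by
    by_cases ht : (t : V) = π 1
    · exact ⟨1, ht.symm, fun _ => rfl⟩
    · obtain ⟨u, hu⟩ := Submodule.mkQ_surjective _ (t : V)
      exact ⟨u, hu, fun h => absurd h ht⟩
  choose e he he1 using hlift
  refine ⟨_, e, fun s c hc t ht => ?_, ?_, fun h => ?_⟩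
  · have h0 : ∑ t ∈ s, Ideal.Quotient.mk I (c t) • b t = 0 := by
      rw [← Submodule.Quotient.mk_eq_zero, ← Submodule.mkQ_apply, map_sum] at hc
      rw [← hc]
      refine Finset.sum_congr rfl fun t _ => ?_
      rw [map_smul, hb, ← he]
      rfl
    exact Ideal.Quotient.eq_zero_iff_mem.1
      (linearIndependent_iff'.1 b.linearIndependent s _ h0 t ht)
  · refine top_le_iff.1 fun u _ => ?_
    have hu : π u ∈ Submodule.map π (Submodule.span A (Set.range e)) := by
      rw [Submodule.map_span, ← Set.range_comp]
      have : π ∘ e = b := funext fun t => by rw [Function.comp_apply, he, hb]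
      rw [this]
      have h1 := b.mem_span (π u)
      rw [← Submodule.restrictScalars_mem A,
        Submodule.restrictScalars_span _ _ Ideal.Quotient.mk_surjective] at h1
      exact h1
    obtain ⟨v, hv, hvu⟩ := hu
    refine Submodule.mem_sup.2 ⟨v, hv, u - v, ?_, add_sub_cancel _ _⟩
    rw [← Submodule.Quotient.mk_eq_zero, ← Submodule.mkQ_apply, map_sub, sub_eq_zero]
    exact hvu.symm
  · have hπ : π 1 ≠ 0 := fun h0 => h ((Submodule.Quotient.mk_eq_zero _).1 h0)
    exact ⟨⟨π 1, hs₀.subset_extend _ ⟨rfl, hπ⟩⟩, he1 _ rfl⟩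

end ResidueBasis

section Tensor

open scoped TensorProduct

variable {A ι : Type*} {B : Type v} {B' : Type*} [CommRing A] [Fintype ι] [DecidableEq ι]
  {y : ι → A} [CommRing B] [Algebra A B] [CommRing B'] [Algebra A B']

omit [DecidableEq ι] in
theorem map_mem_powIdeal (f : B →ₗ[A] B') (n : ι → ℕ) {u : B}
    (hu : u ∈ powIdeal (fun i => algebraMap A B (y i)) Finset.univ n) :
    f u ∈ powIdeal (fun i => algebraMap A B' (y i)) Finset.univ n := by
  rw [← powIdeal_smul_top] at hu ⊢
  exact Submodule.smul_top_le_comap_smul_top _ f hu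

variable [(Ideal.span (Set.range y)).IsMaximal] [IsAdicComplete (Ideal.span (Set.range y)) A]

theorem IsGood.exists_retraction (hy : IsGood fun i => algebraMap A B (y i))
    (h1 : (Ideal.span (Set.range y)).map (algebraMap A B) ≠ ⊤) : ∃ α : B →ₗ[A] A, α 1 = 1 := by
  obtain ⟨τ, e, he, hspan, hone⟩ := exists_residue_basis (B := B) (Ideal.span (Set.range y))
  obtain ⟨t, ht⟩ := hone fun h => h1 <| by
    rw [Ideal.eq_top_iff_one]
    rwa [Ideal.smul_top_eq_map, Submodule.restrictScalars_mem] at h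
  obtain ⟨α, hα, -⟩ := exists_coeff_linearMap hy he hspan t
  exact ⟨α, ht ▸ hα⟩

theorem IsGood.tensorProduct (hy : IsGood fun i => algebraMap A B (y i))
    (hy' : IsGood fun i => algebraMap A B' (y i)) :
    IsGood fun i => algebraMap A (B ⊗[A] B') (y i) := by
  classical
  intro n i w hw
  obtain ⟨τ, e, he, hspan, -⟩ := exists_residue_basis (B := B) (Ideal.span (Set.range y))
  choose α hα hα0 using exists_coeff_linearMap hy he hspan
  set J := powIdeal y Finset.univ n
  let Φ : (τ →₀ B') →ₗ[A] B ⊗[A] B' := Finsupp.lsum A fun t => TensorProduct.mk A B B' (e t)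
  have hΦs (t : τ) (b' : B') : Φ (Finsupp.single t b') = e t ⊗ₜ b' := by simp [Φ]
  have hΦ : LinearMap.range Φ ⊔ J • ⊤ = ⊤ := by
    refine top_le_iff.1 fun w _ => ?_
    induction w with
    | zero => exact zero_mem _
    | add u v hu hv => exact add_mem (hu trivial) (hv trivial)
    | tmul b b' =>
      obtain ⟨k, hk⟩ := exists_span_range_pow_le_powIdeal y n
      have hle : Submodule.span A (Set.range e) ⊔ Ideal.span (Set.range y) ^ k • ⊤ ≤
          (LinearMap.range Φ ⊔ J • ⊤).comap ((TensorProduct.mk A B B').flip b') := by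
        refine sup_le (Submodule.span_le.2 ?_) ?_
        · rintro _ ⟨t, rfl⟩
          exact Submodule.mem_sup_left ⟨Finsupp.single t b', hΦs t b'⟩
        · refine (Submodule.smul_mono_left hk).trans ?_
          exact (Submodule.smul_top_le_comap_smul_top _ _).trans
            (Submodule.comap_mono le_sup_right)
      rw [span_range_sup_pow_smul_top hspan] at hle
      exact hle (show b ∈ _ from trivial)
  obtain ⟨_, ⟨c, rfl⟩, r, hr, rfl⟩ := Submodule.mem_sup.1 (hΦ.ge (show w ∈ _ from trivial))
  rw [powIdeal_smul_top] at hr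
  refine add_mem ?_ hr
  have h1 : algebraMap A (B ⊗[A] B') (y i) * Φ c ∈
      powIdeal (fun i => algebraMap A (B ⊗[A] B') (y i)) Finset.univ
        (Function.update n i (n i + 1)) := by
    have := pow_mul_mem_powIdeal_update n i 1 hr
    rw [pow_one] at this
    simpa [mul_add] using sub_mem hw this
  have hΓ (t : τ) : (TensorProduct.lid A B').toLinearMap ∘ₗ (α t).rTensor B' ∘ₗ Φ =
      Finsupp.lapply t := by
    refine Finsupp.lhom_ext fun t' b' => ?_
    simp only [LinearMap.comp_apply, hΦs, LinearMap.rTensor_tmul, LinearEquiv.coe_coe,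
      TensorProduct.lid_tmul, Finsupp.lapply_apply]
    by_cases h : t' = t
    · subst h; simp [hα]
    · simp [hα0 t t' h, h]
  have h2 (t : τ) : c t ∈ powIdeal (fun i => algebraMap A B' (y i)) Finset.univ n := by
    refine hy' n i _ ?_
    have := map_mem_powIdeal ((TensorProduct.lid A B').toLinearMap ∘ₗ (α t).rTensor B') _ h1
    rw [← Algebra.smul_def, map_smul, Algebra.smul_def] at this
    convert this using 2
    exact (LinearMap.congr_fun (hΓ t) c).symm
  have h3 : Φ c = ∑ t ∈ c.support, TensorProduct.mk A B B' (e t) (c t) := by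
    simp [Φ, Finsupp.sum]
  rw [h3]
  exact sum_mem fun t _ => map_mem_powIdeal _ _ (h2 t)

end Tensor

section Durable

open scoped TensorProduct

variable {A R : Type*} [CommRing A] [IsDomain A] [CommRing R] [IsDomain R] [Algebra A R]

omit [IsDomain R] in
theorem exists_smul_mem_range_lsum {s : Set R}
    (hs : ∀ r ∉ s, ∃ a : A, a ≠ 0 ∧ a • r ∈ Submodule.span A s) (z : R ⊗[A] R) :
    ∃ a : A, a ≠ 0 ∧ a • z ∈ LinearMap.range
      (Finsupp.lsum A fun i : s => (TensorProduct.mk A R R).flip (i : R)) := by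
  set Φ := Finsupp.lsum A fun i : s => (TensorProduct.mk A R R).flip (i : R)
  have hΦ (r : R) (i : s) : r ⊗ₜ (i : R) ∈ LinearMap.range Φ :=
    ⟨Finsupp.single i r, by simp [Φ]⟩
  induction z with
  | zero => exact ⟨1, one_ne_zero, by rw [smul_zero]; exact zero_mem _⟩
  | add u v hu hv =>
    obtain ⟨a, ha, hau⟩ := hu
    obtain ⟨b, hb, hbv⟩ := hv
    refine ⟨a * b, mul_ne_zero ha hb, ?_⟩
    rw [smul_add]
    refine add_mem ?_ ?_
    · rw [mul_comm, mul_smul]; exact Submodule.smul_mem _ _ hau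
    · rw [mul_smul]; exact Submodule.smul_mem _ _ hbv
  | tmul r t =>
    by_cases ht : t ∈ s
    · exact ⟨1, one_ne_zero, by rw [one_smul]; exact hΦ r ⟨t, ht⟩⟩
    · obtain ⟨a, ha, hat⟩ := hs t ht
      refine ⟨a, ha, ?_⟩
      have hle : Submodule.span A s ≤ (LinearMap.range Φ).comap (TensorProduct.mk A R R r) :=
        Submodule.span_le.2 fun i hi => hΦ r ⟨i, hi⟩
      rw [← TensorProduct.tmul_smul]
      exact hle hat

variable [Algebra.IsAlgebraic A R]

theorem lmul_eq_zero_of_forall_rTensor_eq_zero {l : R →ₗ[A] A} (hl : l 1 = 1) (z : R ⊗[A] R)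
    (hz : ∀ r : R, (l ∘ₗ LinearMap.mulLeft A r).rTensor R z = 0) :
    Algebra.TensorProduct.lmul' A z = 0 := by
  classical
  have hinj (a : A) (ha : algebraMap A R a = 0) : a = 0 := by
    have := congr_arg l ha
    rwa [Algebra.algebraMap_eq_smul_one, map_smul, hl, smul_eq_mul, mul_one, map_zero] at this
  obtain ⟨s, hs, hmax⟩ := exists_maximal_linearIndepOn A (id : R → R)
  obtain ⟨a, ha, c, hc⟩ := exists_smul_mem_range_lsum (s := s) (by simpa using hmax) z
  have hsum : a • z = ∑ i ∈ c.support, c i ⊗ₜ[A] (i : R) := by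
    rw [← hc]; simp [Finsupp.sum]
  have hρ (i : s) : c i = 0 := by
    by_contra hi
    obtain ⟨b, hb, r, hr⟩ := (Algebra.IsAlgebraic.isAlgebraic (R := A) (c i)).exists_nonzero_dvd
      (mem_nonZeroDivisors_of_ne_zero hi)
    have h0 := congr_arg (TensorProduct.lid A R) (congr_arg (a • ·) (hz r))
    simp only [← map_smul] at h0
    rw [hsum] at h0
    simp only [map_sum, LinearMap.rTensor_tmul, TensorProduct.lid_tmul, LinearMap.comp_apply,
      LinearMap.mulLeft_apply, smul_zero, map_zero] at h0
    have h1 := linearIndependent_iff'.1 hs c.support (fun j => l (r * c j)) h0 i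
      (Finsupp.mem_support_iff.2 hi)
    rw [mul_comm, ← hr, Algebra.algebraMap_eq_smul_one, map_smul, hl, smul_eq_mul, mul_one] at h1
    exact hb h1
  have h2 : a • Algebra.TensorProduct.lmul' A z = 0 := by
    rw [← map_smul, hsum, Finset.sum_eq_zero fun i _ => by rw [hρ, TensorProduct.zero_tmul],
      map_zero]
  rw [Algebra.smul_def] at h2
  exact (mul_eq_zero.1 h2).resolve_left fun h => ha (hinj a h)

variable {ι B B' : Type*} [Fintype ι] {y : ι → A} [IsHausdorff (Ideal.span (Set.range y)) A]
  [CommRing B] [Algebra A B] [Algebra R B] [IsScalarTower A R B]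
  [CommRing B'] [Algebra A B'] [Algebra R B'] [IsScalarTower A R B']

omit [IsDomain A] in
theorem eq_zero_of_forall_mem_powIdeal (α : B' →ₗ[A] A) (hα : α 1 = 1) {r : R}
    (hr : ∀ k, algebraMap R B' r ∈
      powIdeal (fun i => algebraMap A B' (y i)) Finset.univ fun _ => k) : r = 0 := by
  by_contra h
  obtain ⟨a, ha, t, hat⟩ := (Algebra.IsAlgebraic.isAlgebraic (R := A) r).exists_nonzero_dvd
      (mem_nonZeroDivisors_of_ne_zero h)
  refine ha (IsHausdorff.haus (I := Ideal.span (Set.range y)) inferInstance _ fun k => ?_)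
  rw [SModEq.zero, smul_eq_mul, Ideal.mul_top]
  refine powIdeal_const_le_span_range_pow y k ?_
  have h1 := map_mem_powIdeal α _ (Ideal.mul_mem_right (algebraMap R B' t) _ (hr k))
  rwa [← map_mul, ← hat, ← IsScalarTower.algebraMap_apply, Algebra.algebraMap_eq_smul_one,
    map_smul, hα, smul_eq_mul, mul_one] at h1

theorem lmul_eq_zero_of_forall_mem_powIdeal (α : B →ₗ[A] A) (hα : α 1 = 1)
    (α' : B' →ₗ[A] A) (hα' : α' 1 = 1) (z : R ⊗[A] R)
    (hz : ∀ k, Algebra.TensorProduct.map (IsScalarTower.toAlgHom A R B)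
        (IsScalarTower.toAlgHom A R B') z ∈
      powIdeal (fun i => algebraMap A (B ⊗[A] B') (y i)) Finset.univ fun _ => k) :
    Algebra.TensorProduct.lmul' A z = 0 := by
  let l : R →ₗ[A] A := α ∘ₗ (IsScalarTower.toAlgHom A R B).toLinearMap
  refine lmul_eq_zero_of_forall_rTensor_eq_zero (l := l) (by simp [l, hα]) z fun r => ?_
  rw [← (TensorProduct.lid A R).map_eq_zero_iff]
  refine eq_zero_of_forall_mem_powIdeal (y := y) α' hα' fun k => ?_
  have h1 := map_mem_powIdeal ((TensorProduct.lid A B').toLinearMap ∘ₗ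
    (α ∘ₗ LinearMap.mulLeft A (algebraMap R B r)).rTensor B') _ (hz k)
  convert h1 using 1
  clear hz h1
  induction z with
  | zero => simp
  | add u v hu hv => simp only [map_add, hu, hv]
  | tmul u v =>
    simp [l, Algebra.smul_def, ← IsScalarTower.algebraMap_apply]

end Durable

section Diagonal

open scoped TensorProduct Polynomial

variable {A R : Type*} [CommRing A] [CommRing R] [IsDomain R] [Algebra A R]

open Polynomial in
theorem exists_mul_diagonal_pow_eq_zero {r : R} (hr : IsIntegral A r) :
    ∃ (h : R ⊗[A] R) (k : ℕ), Algebra.TensorProduct.lmul' A h ≠ 0 ∧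
      h * (1 ⊗ₜ r - r ⊗ₜ 1) ^ k = 0 := by
  obtain ⟨f, hf, hfr⟩ := hr
  obtain ⟨q, hq, hqr⟩ := exists_eq_pow_rootMultiplicity_mul_and_not_dvd (f.map (algebraMap A R))
    (hf.map _).ne_zero r
  set k := (f.map (algebraMap A R)).rootMultiplicity r
  let ι : R →+* R ⊗[A] R := Algebra.TensorProduct.includeLeftRingHom
  refine ⟨q.eval₂ ι (1 ⊗ₜ r), k, ?_, ?_⟩
  · have h1 : Algebra.TensorProduct.lmul' A (q.eval₂ ι (1 ⊗ₜ r)) = q.eval r := by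
      have := hom_eval₂ q ι (Algebra.TensorProduct.lmul' A (S := R)).toRingHom (1 ⊗ₜ r)
      have h2 : ((Algebra.TensorProduct.lmul' A (S := R)).toRingHom).comp ι = RingHom.id R := by
        ext x; simp [ι]
      rw [h2] at this
      refine this.trans ?_
      rw [show (Algebra.TensorProduct.lmul' A (S := R)).toRingHom (1 ⊗ₜ[A] r) = r from one_mul r]
      rfl
    rwa [h1, Ne, ← IsRoot.def, ← dvd_iff_isRoot]
  · have h1 := congr_arg (eval₂ ι (1 ⊗ₜ[A] r)) hq
    rw [eval₂_mul, eval₂_pow, eval₂_sub, eval₂_X, eval₂_C, eval₂_map] at h1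
    have h2 : ι.comp (algebraMap A R) = (Algebra.TensorProduct.includeRight
        (R := A) (A := R) (B := R)).toRingHom.comp (algebraMap A R) :=
      RingHom.ext fun x => Algebra.TensorProduct.tmul_one_eq_one_tmul x
    have h3 : eval₂ (ι.comp (algebraMap A R)) (1 ⊗ₜ[A] r) f = 0 := by
      have := hom_eval₂ f (algebraMap A R) (Algebra.TensorProduct.includeRight
        (R := A) (A := R) (B := R)).toRingHom r
      rw [hfr, map_zero] at this
      rw [h2]
      exact this.symm
    rw [h3] at h1
    rw [mul_comm]
    exact h1.symm

theorem exists_forall_finset_mul_diagonal_pow_eq_zero [Algebra.IsIntegral A R] (s : Finset R) :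
    ∃ (h : R ⊗[A] R) (k : ℕ), Algebra.TensorProduct.lmul' A h ≠ 0 ∧
      ∀ r ∈ s, ∀ m, k ≤ m → h * (1 ⊗ₜ r - r ⊗ₜ 1) ^ m = 0 := by
  classical
  induction s using Finset.induction_on with
  | empty => exact ⟨1, 0, by simp, by simp⟩
  | insert a s _ ih =>
    obtain ⟨h, k, hh, hk⟩ := ih
    obtain ⟨h', k', hh', hk'⟩ :=
      exists_mul_diagonal_pow_eq_zero (Algebra.IsIntegral.isIntegral (R := A) a)
    refine ⟨h * h', max k k', by rw [map_mul]; exact mul_ne_zero hh hh', fun r hr m hm => ?_⟩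
    rcases Finset.mem_insert.1 hr with rfl | hr
    · rw [← Nat.add_sub_cancel' ((le_max_right k k').trans hm), pow_add, mul_assoc h,
        ← mul_assoc h', hk', zero_mul, mul_zero]
    · rw [mul_comm h, mul_assoc, hk r hr m ((le_max_left _ _).trans hm), mul_zero]

theorem exists_forall_mul_diagonal_pow_eq_zero [Module.Finite A R] (p : ℕ) [Fact p.Prime]
    [CharP R p] : ∃ (h : R ⊗[A] R) (k : ℕ), Algebra.TensorProduct.lmul' A h ≠ 0 ∧
      ∀ r m, k ≤ m → h * (1 ⊗ₜ r - r ⊗ₜ 1) ^ p ^ m = 0 := by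
  obtain ⟨s, hs⟩ := Module.Finite.fg_top (R := A) (M := R)
  obtain ⟨h, k, hh, hk⟩ := exists_forall_finset_mul_diagonal_pow_eq_zero (A := A) s
  have : Nontrivial (R ⊗[A] R) :=
    nontrivial_of_ne h 0 fun h0 => hh (by rw [h0, map_zero])
  have : CharP (R ⊗[A] R) p := by
    rw [CharP.charP_iff_prime_eq_zero Fact.out, ← map_natCast (algebraMap R (R ⊗[A] R)),
      CharP.cast_eq_zero, map_zero]
  refine ⟨h, k, hh, fun r m hm => ?_⟩
  have hr : r ∈ Submodule.span A (s : Set R) := hs ▸ trivial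
  induction hr using Submodule.span_induction with
  | mem r hr =>
    exact hk r hr _ (hm.trans (Nat.lt_pow_self (Fact.out : p.Prime).one_lt).le)
  | zero =>
    rw [TensorProduct.tmul_zero, TensorProduct.zero_tmul, sub_zero,
      zero_pow (pow_ne_zero _ (Fact.out : p.Prime).ne_zero), mul_zero]
  | add u v _ _ hu hv =>
    rw [TensorProduct.tmul_add, TensorProduct.add_tmul, add_sub_add_comm, add_pow_char_pow,
      mul_add, hu, hv, add_zero]
  | smul a u _ hu =>
    rw [TensorProduct.tmul_smul, ← TensorProduct.smul_tmul', ← smul_sub, smul_pow, mul_smul_comm,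
      hu, smul_zero]

end Diagonal

section Perfection

open scoped TensorProduct

theorem exists_glue {A R ι : Type*} [CommRing A] [IsDomain A] [CommRing R] [IsDomain R]
    [Algebra A R] [Module.Finite A R] [Fintype ι] [DecidableEq ι] {y : ι → A}
    [(Ideal.span (Set.range y)).IsMaximal] [IsAdicComplete (Ideal.span (Set.range y)) A]
    (p : ℕ) [Fact p.Prime] [CharP R p] {B : Type v} {B' : Type w}
    [CommRing B] [Algebra A B] [Algebra R B] [IsScalarTower A R B]
    [CommRing B'] [Algebra A B'] [Algebra R B'] [IsScalarTower A R B']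
    (hy : IsGood fun i => algebraMap A B (y i)) (hy' : IsGood fun i => algebraMap A B' (y i))
    (h1 : (Ideal.span (Set.range y)).map (algebraMap A B) ≠ ⊤)
    (h1' : (Ideal.span (Set.range y)).map (algebraMap A B') ≠ ⊤) :
    ∃ (C : Type (max v w)) (_ : CommRing C) (φ : B →+* C) (φ' : B' →+* C),
      φ.comp (algebraMap R B) = φ'.comp (algebraMap R B') ∧
      IsGood (fun i => φ (algebraMap A B (y i))) ∧
      Ideal.span (Set.range fun i => φ (algebraMap A B (y i))) ≠ ⊤ := by
  obtain ⟨α, hα⟩ := hy.exists_retraction h1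
  obtain ⟨α', hα'⟩ := hy'.exists_retraction h1'
  obtain ⟨h, k, hh, hk⟩ := exists_forall_mul_diagonal_pow_eq_zero (A := A) (R := R) p
  let W := B ⊗[A] B'
  let θ : R ⊗[A] R →ₐ[A] W := Algebra.TensorProduct.map (IsScalarTower.toAlgHom A R B)
    (IsScalarTower.toAlgHom A R B')
  have hθ : ∀ z : R ⊗[A] R, (∀ n, θ z ∈
      powIdeal (fun i => algebraMap A W (y i)) Finset.univ fun _ => n) →
      Algebra.TensorProduct.lmul' A z = 0 :=
    lmul_eq_zero_of_forall_mem_powIdeal α hα α' hα'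
  have hW : Nontrivial W := by
    by_contra hW
    rw [not_nontrivial_iff_subsingleton] at hW
    have := hθ 1 fun n => by rw [Subsingleton.elim (θ 1) 0]; exact zero_mem _
    rw [map_one] at this
    exact one_ne_zero this
  have hWp : CharP W p := by
    rw [CharP.charP_iff_prime_eq_zero Fact.out, ← map_natCast (algebraMap R W), CharP.cast_eq_zero,
      map_zero]
  let j : W →+* ℕ → W := RingHom.pi fun n => iterateFrobenius W p (n + k)
  have hj (u : W) (n : ℕ) : j u n = u ^ p ^ (n + k) := rfl
  let H : ℕ → W := fun _ => θ h
  let C := Localization.Away H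
  let γ : W →+* C := (algebraMap (ℕ → W) C).comp j
  have hz (r : R) : γ (θ (1 ⊗ₜ r - r ⊗ₜ 1)) = 0 := by
    rw [RingHom.comp_apply, IsLocalization.map_eq_zero_iff (Submonoid.powers H)]
    refine ⟨⟨H, Submonoid.mem_powers H⟩, funext fun n => ?_⟩
    rw [Pi.mul_apply, hj, ← map_pow, ← map_mul, hk r _ (Nat.le_add_left k n), map_zero,
      Pi.zero_apply]
  have hφ (i : ι) : γ (algebraMap A W (y i)) =
      γ.comp Algebra.TensorProduct.includeLeftRingHom (algebraMap A B (y i)) := rfl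
  refine ⟨C, inferInstance, γ.comp Algebra.TensorProduct.includeLeftRingHom,
    γ.comp Algebra.TensorProduct.includeRight.toRingHom, RingHom.ext fun r => ?_, ?_, ?_⟩
  · have := hz r
    have hl : θ (r ⊗ₜ 1) = algebraMap R B r ⊗ₜ 1 :=
      (Algebra.TensorProduct.map_tmul ..).trans (by rw [map_one]; rfl)
    have hr : θ (1 ⊗ₜ r) = 1 ⊗ₜ algebraMap R B' r :=
      (Algebra.TensorProduct.map_tmul ..).trans (by rw [map_one]; rfl)
    rw [map_sub, map_sub, sub_eq_zero, hl, hr] at this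
    exact this.symm
  · simp only [← hφ]
    have hgood : IsGood fun i => j (algebraMap A W (y i)) :=
      IsGood.pi fun n => (hy.tensorProduct hy').pow _
    exact hgood.localization (Submonoid.powers H)
  · simp only [← hφ]
    have : Set.range (fun i => γ (algebraMap A W (y i))) =
        algebraMap (ℕ → W) C '' Set.range fun i => j (algebraMap A W (y i)) := by
      rw [← Set.range_comp]; rfl
    rw [this, ← Ideal.map_span,
      IsLocalization.map_algebraMap_ne_top_iff_disjoint (Submonoid.powers H), Set.disjoint_left]
    rintro _ ⟨N, rfl⟩ hN
    have h2 : Algebra.TensorProduct.lmul' A (h ^ N) = 0 := hθ _ fun n => by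
      have h3 : (H ^ N) n ∈
          (Ideal.span (Set.range fun i => j (algebraMap A W (y i)))).map (Pi.evalRingHom _ n) :=
        Ideal.mem_map_of_mem (Pi.evalRingHom (fun _ => W) n) hN
      rw [Ideal.map_span, ← Set.range_comp] at h3
      rw [map_pow]
      refine (Ideal.span_le.2 ?_ :
        _ ≤ powIdeal (fun i => algebraMap A W (y i)) Finset.univ fun _ => n) h3
      rintro _ ⟨i, rfl⟩
      refine Ideal.pow_mem_of_pow_mem _ (pow_mem_powIdeal (fun _ => n) (Finset.mem_univ i)) ?_
      exact (Nat.le_add_right n k).trans (Nat.lt_pow_self (Fact.out : p.Prime).one_lt).le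
    rw [map_pow] at h2
    exact pow_ne_zero N hh h2

end Perfection

section Main

variable {R : Type u} [CommRing R] [IsLocalRing R]

theorem IsSOP.map_maximalIdeal_eq_top [IsNoetherianRing R] {d : ℕ} {x : Fin d → R}
    (hx : IsSOP R x) {C : Type*} [CommRing C] (f : R →+* C) (h : (maximalIdeal R).map f = ⊤) :
    (Ideal.span (Set.range x)).map f = ⊤ := by
  obtain ⟨k, hk⟩ := hx.maximalIdeal_pow_le fun _ => 1
  have h1 : powIdeal x Finset.univ (fun _ => 1) = Ideal.span (Set.range x) := by simp [powIdeal]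
  rw [h1] at hk
  refine top_le_iff.1 (le_trans ?_ (Ideal.map_mono (f := f) hk))
  rw [Ideal.map_pow, h, Ideal.top_pow]

theorem IsBalancedBigCM.isBigCM {S : Type*} [CommRing S] [Algebra R S]
    (h : IsBalancedBigCM R S) {d : ℕ} {x : Fin d → R} (hx : IsSOP R x) : IsBigCM R S :=
  ⟨⟨d, x, hx, h.1 d x hx⟩, h.2⟩

theorem IsBigCM.exists_dominating [IsDomain R] [IsNoetherianRing R]
    [IsAdicComplete (maximalIdeal R) R] (p : ℕ) [Fact p.Prime] [CharP R p]
    {B : Type v} [CommRing B] [Algebra R B] {B' : Type w} [CommRing B'] [Algebra R B']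
    (hB : IsBigCM R B) (hB' : IsBigCM R B') :
    ∃ (C : Type (max v w)) (_ : CommRing C) (_ : Algebra R C),
      IsBalancedBigCM R C ∧ Nonempty (B →ₐ[R] C) ∧ Nonempty (B' →ₐ[R] C) := by
  obtain ⟨⟨d, x, hx, hxB⟩, hmB⟩ := hB
  obtain ⟨T, _, _, ⟨hT, hmT⟩, ⟨g⟩⟩ := hB'.exists_isBalancedBigCM
  obtain ⟨A, _, _, _, y, hmax, hcomp, hfin, hyx⟩ := hx.exists_finite_regular p
  let _ : Algebra A B := Algebra.compHom B (algebraMap A R)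
  let _ : Algebra A T := Algebra.compHom T (algebraMap A R)
  have : IsScalarTower A R B := .of_algebraMap_eq fun _ => rfl
  have : IsScalarTower A R T := .of_algebraMap_eq fun _ => rfl
  have hle : (Ideal.span (Set.range y)).map (algebraMap A R) ≤ maximalIdeal R := by
    rw [Ideal.map_span, Ideal.span_le]
    rintro _ ⟨_, ⟨i, rfl⟩, rfl⟩
    rw [hyx]
    exact hx.2.1 i
  obtain ⟨C, _, φ, φ', hφ, hgood, htop⟩ :=
    exists_glue (A := A) (R := R) (y := y) p (B := B) (B' := T)
    (by simpa only [IsScalarTower.algebraMap_apply A R B, hyx] using hxB.isGood)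
    (by simpa only [IsScalarTower.algebraMap_apply A R T, hyx] using (hT d x hx).isGood)
    (fun h => hmB <| by
      rw [IsScalarTower.algebraMap_eq A R B, ← Ideal.map_map] at h
      exact top_le_iff.1 (h.ge.trans (Ideal.map_mono hle)))
    (fun h => hmT <| by
      rw [IsScalarTower.algebraMap_eq A R T, ← Ideal.map_map] at h
      exact top_le_iff.1 (h.ge.trans (Ideal.map_mono hle)))
  simp only [IsScalarTower.algebraMap_apply A R B, hyx] at hgood htop
  let _ : Algebra R C := (φ.comp (algebraMap R B)).toAlgebra
  have hmC : (maximalIdeal R).map (algebraMap R C) ≠ ⊤ := fun h => htop <| by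
    have := hx.map_maximalIdeal_eq_top _ h
    rwa [Ideal.map_span, ← Set.range_comp] at this
  obtain ⟨D, _, _, hD, ⟨q⟩⟩ := exists_isBalancedBigCM_of_isGood (C := C) hx hgood hmC
  refine ⟨D, inferInstance, inferInstance, hD, ⟨q.comp ⟨φ, fun _ => rfl⟩⟩,
    ⟨(q.comp ⟨φ', fun r => ?_⟩).comp g⟩⟩
  exact (RingHom.congr_fun hφ r).symm

end Main

/-- **Theorem (Dietz, Thm. 8.4 / `product`).** Let `(R,m)` be a complete Noetherian local
domain of positive prime characteristic `p`. If `S` and `S'` are seeds over `R`, then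
`S ⊗_R S'` is a seed over `R`. Consequently, any two big Cohen-Macaulay `R`-algebras `B`
and `B'` map to a common balanced big Cohen-Macaulay `R`-algebra `C`. -/
theorem tensor_product_of_seeds
    (R : Type u) [CommRing R] [IsDomain R] [IsLocalRing R] [IsNoetherianRing R]
    [IsAdicComplete (maximalIdeal R) R]
    (p : ℕ) [Fact p.Prime] [CharP R p]
    (S S' : Type u) [CommRing S] [CommRing S'] [Algebra R S] [Algebra R S'] :
    (IsSeed R S → IsSeed R S' → IsSeed R (TensorProduct R S S')) ∧
    (∀ (B : Type u) (_ : CommRing B) (_ : Algebra R B)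
       (B' : Type u) (_ : CommRing B') (_ : Algebra R B'),
      IsBigCM R B → IsBigCM R B' →
      ∃ (C : Type u) (_ : CommRing C) (_ : Algebra R C),
        IsBalancedBigCM R C ∧ Nonempty (B →ₐ[R] C) ∧ Nonempty (B' →ₐ[R] C)) := by
  refine ⟨?_, fun B _ _ B' _ _ hB hB' => hB.exists_dominating p hB'⟩
  rintro ⟨B, _, _, hB, ⟨f⟩⟩ ⟨B', _, _, hB', ⟨f'⟩⟩
  obtain ⟨C, _, _, hC, ⟨g⟩, ⟨g'⟩⟩ := hB.exists_dominating p hB'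
  obtain ⟨⟨d, x, hx, -⟩, -⟩ := hB
  exact ⟨C, inferInstance, inferInstance, hC.isBigCM hx,
    ⟨Algebra.TensorProduct.productMap (g.comp f) (g'.comp f')⟩⟩
end
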